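/- arXiv:2112.00630 — 5 statements merged into one kernel-verified Lean document; each statement's English description precedes it below -/
import Mathlib

section
/- For the free group F_r on r generators (r a positive natural number or countably infinite), the function g ↦ ‖g‖₂² (the squared ℓ² length of g) is conditionally negative definite on F_r; equivalently, for every real s with 0 ≤ s ≤ 1, the function g ↦ s^{‖g‖₂²} is positive definite on F_r. -/
open ComplexOrder

/-- Sum of squared block lengths of a reduced word, given the generator of the
current block and its current length. Blocks are maximal runs of the same generator. -/
def blockSqSumAux {ι : Type*} [DecidableEq ι] (a : ι) (n : ℕ) :
    List (ι × Bool) → ℕ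
  | [] => n ^ 2
  | (b, _) :: l => if b = a then blockSqSumAux a (n + 1) l else n ^ 2 + blockSqSumAux b 1 l

/-- The squared ℓ² length of an element of a free group: for a reduced block form
`g = a₁^{k₁} ⋯ a_n^{k_n}` it equals `∑ i, k_i²`. -/
def l2sq {ι : Type*} [DecidableEq ι] (g : FreeGroup ι) : ℕ :=
  match FreeGroup.toWord g with
  | [] => 0
  | (a, _) :: l => blockSqSumAux a 1 l

/-- A real-valued function on a group is positive definite. -/
def IsPositiveDefinite {G : Type*} [Group G] (φ : G → ℝ) : Prop :=
  ∀ (n : ℕ) (x : Fin n → G) (c : Fin n → ℂ),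
    0 ≤ ∑ j, ∑ k, c j * (starRingEnd ℂ) (c k) * (φ ((x j)⁻¹ * x k) : ℂ)

/-- A real-valued function on a group is conditionally negative definite. -/
def IsCondNegDef {G : Type*} [Group G] (ψ : G → ℝ) : Prop :=
  (∀ g : G, ψ g⁻¹ = ψ g) ∧
    ∀ (n : ℕ) (x : Fin n → G) (c : Fin n → ℂ), (∑ j, c j) = 0 →
      ∑ j, ∑ k, c j * (starRingEnd ℂ) (c k) * (ψ ((x j)⁻¹ * x k) : ℂ) ≤ 0


namespace L2Sq

/-- The quadratic form with real kernel `K` is positive semidefinite. -/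
def PSDk {n : ℕ} (K : Fin n → Fin n → ℝ) : Prop :=
  ∀ c : Fin n → ℂ, 0 ≤ ∑ j, ∑ k, c j * (starRingEnd ℂ) (c k) * (K j k : ℂ)

theorem PSDk.gram_mul {n : ℕ} {I : Type*} (S : Finset I) (u : Fin n → I → ℝ)
    {L : Fin n → Fin n → ℝ} (hL : PSDk L) :
    PSDk (fun j k => (∑ i ∈ S, u j i * u k i) * L j k) := by
  intro c
  have h : ∑ j, ∑ k, c j * (starRingEnd ℂ) (c k) *
      (((∑ i ∈ S, u j i * u k i) * L j k : ℝ) : ℂ) =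
      ∑ i ∈ S, ∑ j, ∑ k, (c j * (u j i : ℂ)) * (starRingEnd ℂ) (c k * (u k i : ℂ)) *
        (L j k : ℂ) := by
    rw [Finset.sum_comm]
    simp_rw [Finset.sum_comm (s := S)]
    rw [Finset.sum_comm]
    refine Finset.sum_congr rfl fun j _ => Finset.sum_congr rfl fun k _ => ?_
    push_cast
    rw [Finset.sum_mul, Finset.mul_sum]
    refine Finset.sum_congr rfl fun i _ => ?_
    simp only [map_mul, Complex.conj_ofReal]
    ring
  rw [h]
  exact Finset.sum_nonneg fun i _ => hL _

theorem PSDk.one {n : ℕ} : PSDk (fun _ _ : Fin n => (1 : ℝ)) := by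
  intro c
  have h : ∑ j, ∑ k, c j * (starRingEnd ℂ) (c k) * ((1 : ℝ) : ℂ) =
      (∑ j, c j) * star (∑ j, c j) := by
    rw [star_sum, Finset.sum_mul_sum]
    simp
  rw [h]
  exact mul_star_self_nonneg _

theorem PSDk.gram_pow {n : ℕ} {I : Type*} (S : Finset I) (u : Fin n → I → ℝ) (m : ℕ) :
    PSDk (fun j k => (∑ i ∈ S, u j i * u k i) ^ m) := by
  induction m with
  | zero => simpa using PSDk.one
  | succ m ih => simpa only [pow_succ'] using PSDk.gram_mul S u ih

theorem PSDk.smul {n : ℕ} {K : Fin n → Fin n → ℝ} (hK : PSDk K) {r : ℝ} (hr : 0 ≤ r) :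
    PSDk (fun j k => r * K j k) := by
  intro c
  have h := mul_nonneg (Complex.zero_le_real.2 hr) (hK c)
  rw [Finset.mul_sum] at h
  simp_rw [Finset.mul_sum] at h
  refine h.trans_eq (Finset.sum_congr rfl fun j _ => Finset.sum_congr rfl fun k _ => ?_)
  push_cast
  ring

theorem PSDk.sum {n : ℕ} {ι : Type*} (s : Finset ι) {K : ι → Fin n → Fin n → ℝ}
    (hK : ∀ i, PSDk (K i)) : PSDk (fun j k => ∑ i ∈ s, K i j k) := by
  intro c
  have h := Finset.sum_nonneg (s := s) fun i _ => hK i c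
  convert h using 1
  simp_rw [Finset.sum_comm (s := s)]
  refine Finset.sum_congr rfl fun j _ => Finset.sum_congr rfl fun k _ => ?_
  push_cast
  rw [Finset.mul_sum]

theorem PSDk.lim {n : ℕ} {α : Type*} {l : Filter α} [l.NeBot] {K : α → Fin n → Fin n → ℝ}
    {K' : Fin n → Fin n → ℝ} (hK : ∀ᶠ a in l, PSDk (K a))
    (h : ∀ j k, Filter.Tendsto (fun a => K a j k) l (nhds (K' j k))) : PSDk K' := by
  intro c
  refine ge_of_tendsto (f := fun a => ∑ j, ∑ k, c j * (starRingEnd ℂ) (c k) * (K a j k : ℂ))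
    (x := l) ?_ (hK.mono fun a ha => ha c)
  refine tendsto_finsetSum _ fun j _ => tendsto_finsetSum _ fun k _ => ?_
  exact Filter.Tendsto.const_mul _ ((Complex.continuous_ofReal.tendsto _).comp (h j k))

theorem PSDk.gram_exp {n : ℕ} {I : Type*} (S : Finset I) (u : Fin n → I → ℝ) {t : ℝ}
    (ht : 0 ≤ t) : PSDk (fun j k => Real.exp (t * ∑ i ∈ S, u j i * u k i)) := by
  have key : ∀ N : ℕ, PSDk (fun j k => ∑ m ∈ Finset.range N,
      (t ^ m / (m.factorial : ℝ)) * (∑ i ∈ S, u j i * u k i) ^ m) := fun N =>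
    PSDk.sum _ fun m => (PSDk.gram_pow S u m).smul (by positivity)
  refine PSDk.lim (l := Filter.atTop) (Filter.Eventually.of_forall key) fun j k => ?_
  have h := (NormedSpace.expSeries_div_hasSum_exp (𝔸 := ℝ)
    (t * ∑ i ∈ S, u j i * u k i)).tendsto_sum_nat
  rw [← Real.exp_eq_exp_ℝ] at h
  refine h.congr fun N => Finset.sum_congr rfl fun m _ => ?_
  rw [mul_pow]; ring

theorem PSDk.conj {n : ℕ} {K : Fin n → Fin n → ℝ} (hK : PSDk K) (d : Fin n → ℝ) :
    PSDk (fun j k => d j * d k * K j k) := by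
  intro c
  refine (hK (fun j => c j * d j)).trans_eq
    (Finset.sum_congr rfl fun j _ => Finset.sum_congr rfl fun k _ => ?_)
  simp only [map_mul, Complex.conj_ofReal]
  push_cast
  ring

/-- Schoenberg for Gram-type distance kernels. -/
theorem psd_pow {n : ℕ} {I : Type*} (S : Finset I) (u : Fin n → I → ℝ) (D : Fin n → Fin n → ℕ)
    (hD : ∀ j k, (D j k : ℝ) = ∑ i ∈ S, (u k i - u j i) ^ 2) (s : ℝ) (hs : 0 ≤ s)
    (hs1 : s ≤ 1) : PSDk (fun j k => s ^ D j k) := by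
  have pos : ∀ s : ℝ, 0 < s → s ≤ 1 → PSDk (fun j k => s ^ D j k) := by
    intro s hs hs1
    have hl : 0 ≤ 2 * (-Real.log s) := by
      have := Real.log_nonpos hs.le hs1
      linarith
    have h := (PSDk.gram_exp S u hl).conj (fun j => Real.exp (Real.log s * ∑ i ∈ S, u j i ^ 2))
    convert h using 3 with j k
    rw [← Real.exp_add, ← Real.exp_add, ← Real.rpow_natCast, Real.rpow_def_of_pos hs, hD]
    congr 1
    simp only [sub_sq, Finset.sum_add_distrib, Finset.sum_sub_distrib]
    have : ∑ x ∈ S, 2 * u k x * u j x = 2 * ∑ x ∈ S, u j x * u k x := by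
      rw [Finset.mul_sum]
      exact Finset.sum_congr rfl fun i _ => by ring
    rw [this]
    ring
  rcases hs.eq_or_lt with rfl | hs
  · refine PSDk.lim (l := nhdsWithin (0 : ℝ) (Set.Ioi 0)) (K := fun s j k => s ^ D j k) ?_ ?_
    · have : Set.Ioc (0 : ℝ) 1 ∈ nhdsWithin (0 : ℝ) (Set.Ioi 0) :=
        Ioc_mem_nhdsGT one_pos
      filter_upwards [this] with s hs using pos s hs.1 hs.2
    · intro j k
      exact ((continuous_pow (D j k)).tendsto (0 : ℝ)).mono_left nhdsWithin_le_nhds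
  · exact pos s hs hs1

theorem cnd_of_gram {n : ℕ} {I : Type*} (S : Finset I) (u : Fin n → I → ℝ)
    (D : Fin n → Fin n → ℕ)
    (hD : ∀ j k, (D j k : ℝ) = ∑ i ∈ S, (u k i - u j i) ^ 2) (c : Fin n → ℂ)
    (hc : ∑ j, c j = 0) :
    ∑ j, ∑ k, c j * (starRingEnd ℂ) (c k) * (((D j k : ℕ) : ℝ) : ℂ) ≤ 0 := by
  have h := (PSDk.gram_pow S u 1).smul (r := 2) (by norm_num) c
  have e : ∑ j, ∑ k, c j * (starRingEnd ℂ) (c k) * (((D j k : ℕ) : ℝ) : ℂ) =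
      (∑ j, c j * ((∑ i ∈ S, u j i ^ 2 : ℝ) : ℂ)) * (starRingEnd ℂ) (∑ k, c k) +
      (∑ j, c j) * (∑ k, (starRingEnd ℂ) (c k) * ((∑ i ∈ S, u k i ^ 2 : ℝ) : ℂ)) -
      ∑ j, ∑ k, c j * (starRingEnd ℂ) (c k) *
        ((2 * (∑ i ∈ S, u j i * u k i) ^ 1 : ℝ) : ℂ) := by
    rw [map_sum, Finset.sum_mul_sum, Finset.sum_mul_sum, ← Finset.sum_add_distrib,
      ← Finset.sum_sub_distrib]
    refine Finset.sum_congr rfl fun j _ => ?_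
    rw [← Finset.sum_add_distrib, ← Finset.sum_sub_distrib]
    refine Finset.sum_congr rfl fun k _ => ?_
    have : (D j k : ℝ) = (∑ i ∈ S, u j i ^ 2) + (∑ i ∈ S, u k i ^ 2) -
        2 * (∑ i ∈ S, u j i * u k i) ^ 1 := by
      rw [hD, pow_one, Finset.mul_sum, ← Finset.sum_add_distrib, ← Finset.sum_sub_distrib]
      exact Finset.sum_congr rfl fun i _ => by ring
    rw [this]
    push_cast
    ring
  rw [e, hc]
  simpa using h

end L2Sq

namespace L2Sq

set_option linter.unusedSectionVars false

variable {ι : Type*} [DecidableEq ι]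

/-- Index set: all cosets of the cyclic subgroups generated by the generators. -/
abbrev Idx (ι : Type*) : Type _ :=
  Σ i : ι, FreeGroup ι ⧸ Subgroup.zpowers (FreeGroup.of i)

/-- The trivial coset of the `i`-th cyclic subgroup. -/
def base (i : ι) : Idx ι := ⟨i, ((1 : FreeGroup ι) : FreeGroup ι ⧸ _)⟩

theorem of_smul_base (i : ι) : FreeGroup.of i • base i = base i := by
  unfold base
  refine Sigma.ext rfl (heq_of_eq ?_)
  change ((FreeGroup.of i * 1 : FreeGroup ι) : FreeGroup ι ⧸ Subgroup.zpowers (FreeGroup.of i)) =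
    ((1 : FreeGroup ι) : FreeGroup ι ⧸ Subgroup.zpowers (FreeGroup.of i))
  rw [eq_comm, QuotientGroup.eq]
  simp

theorem of_inv_smul_base (i : ι) : (FreeGroup.of i)⁻¹ • base i = base i := by
  rw [inv_smul_eq_iff, of_smul_base]

/-- Translation of finitely supported functions on the index set. -/
noncomputable def tr (g : FreeGroup ι) : (Idx ι →₀ ℝ) ≃ₗ[ℝ] (Idx ι →₀ ℝ) :=
  Finsupp.domLCongr (MulAction.toPerm g)

theorem tr_apply (g : FreeGroup ι) (v : Idx ι →₀ ℝ) (x : Idx ι) : tr g v x = v (g⁻¹ • x) := by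
  simp [tr, Finsupp.domLCongr_apply]

/-- The affine action. -/
noncomputable def aff : FreeGroup ι →* Equiv.Perm (Idx ι →₀ ℝ) :=
  FreeGroup.lift fun i =>
    (tr (FreeGroup.of i)).toEquiv.trans (Equiv.addRight (Finsupp.single (base i) 1))

/-- The cocycle. -/
noncomputable def coc (g : FreeGroup ι) : Idx ι →₀ ℝ := aff g 0

theorem aff_of (i : ι) (v : Idx ι →₀ ℝ) :
    aff (FreeGroup.of i) v = tr (FreeGroup.of i) v + Finsupp.single (base i) 1 := by
  simp [aff]

theorem aff_of_inv (i : ι) (v : Idx ι →₀ ℝ) :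
    aff (FreeGroup.of i)⁻¹ v = tr (FreeGroup.of i)⁻¹ v - Finsupp.single (base i) 1 := by
  rw [map_inv, Equiv.Perm.inv_eq_iff_eq, aff_of]
  ext x
  have : (FreeGroup.of i)⁻¹ • x = base i ↔ x = base i := by
    rw [inv_smul_eq_iff, of_smul_base]
  simp only [map_sub, Finsupp.add_apply, Finsupp.sub_apply, tr_apply, Finsupp.single_apply,
    inv_inv, smul_inv_smul, eq_comm (a := base i), this]
  ring

theorem aff_eq (g : FreeGroup ι) : ∀ v : Idx ι →₀ ℝ, aff g v = tr g v + coc g := by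
  have tr1 : ∀ v : Idx ι →₀ ℝ, tr 1 v = v := fun v => by ext x; simp [tr_apply]
  have trm : ∀ (g h : FreeGroup ι) (v : Idx ι →₀ ℝ), tr (g * h) v = tr g (tr h v) :=
    fun g h v => by ext x; simp [tr_apply, mul_smul]
  induction g using FreeGroup.induction_on with
  | C1 => intro v; simp [coc, tr1]
  | of i => intro v; rw [coc, aff_of, aff_of]; simp
  | inv_of i _ => intro v; rw [coc, aff_of_inv, aff_of_inv]; simp [sub_eq_add_neg]
  | mul g h hg hh =>
    intro v
    rw [coc, map_mul, Equiv.Perm.mul_apply, Equiv.Perm.mul_apply, hh, hg, hh 0, hg, trm]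
    simp only [map_add, map_zero]
    abel

theorem coc_mul (g h : FreeGroup ι) : coc (g * h) = tr g (coc h) + coc g := by
  rw [← aff_eq, coc, map_mul, Equiv.Perm.mul_apply, ← coc]

theorem coc_one : coc (1 : FreeGroup ι) = 0 := by simp [coc]

/-- sign of a letter -/
def sg (s : Bool) : ℝ := if s then 1 else -1

theorem sg_sq (s : Bool) : sg s * sg s = 1 := by cases s <;> simp [sg]

theorem mk_cons (l : ι × Bool) (w : List (ι × Bool)) :
    FreeGroup.mk (l :: w) = FreeGroup.mk [l] * FreeGroup.mk w := by
  rw [FreeGroup.mul_mk]; rfl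

theorem mk_single (i : ι) (s : Bool) :
    FreeGroup.mk [(i, s)] = if s then FreeGroup.of i else (FreeGroup.of i)⁻¹ := by
  cases s <;> simp [FreeGroup.of, FreeGroup.inv_mk, FreeGroup.invRev]

theorem letter_inv_smul_base (i : ι) (s : Bool) :
    (FreeGroup.mk [(i, s)])⁻¹ • base i = base i := by
  rw [mk_single]; cases s
  · simp [of_smul_base]
  · simp [of_inv_smul_base]

theorem coc_letter (i : ι) (s : Bool) :
    coc (FreeGroup.mk [(i, s)]) = Finsupp.single (base i) (sg s) := by
  rw [mk_single, coc]
  cases s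
  · rw [if_neg (by simp), aff_of_inv]; simp [sg]
  · simp [aff_of, sg]

theorem coc_cons (i : ι) (s : Bool) (w : List (ι × Bool)) :
    coc (FreeGroup.mk ((i, s) :: w)) =
      tr (FreeGroup.mk [(i, s)]) (coc (FreeGroup.mk w)) + Finsupp.single (base i) (sg s) := by
  rw [mk_cons, coc_mul, coc_letter]

/-- Squared norm. -/
noncomputable def nsq (v : Idx ι →₀ ℝ) : ℝ := v.sum fun _ a => a ^ 2

theorem nsq_eq (v : Idx ι →₀ ℝ) (S : Finset (Idx ι)) (h : v.support ⊆ S) :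
    nsq v = ∑ i ∈ S, v i ^ 2 :=
  Finsupp.sum_of_support_subset _ h _ (by simp)

theorem nsq_tr (g : FreeGroup ι) (v : Idx ι →₀ ℝ) : nsq (tr g v) = nsq v := by
  simp [nsq, tr, Finsupp.domLCongr_apply, Finsupp.domCongr_apply, Finsupp.sum_equivMapDomain]

theorem nsq_add_single (v : Idx ι →₀ ℝ) (x : Idx ι) (c : ℝ) :
    nsq (v + Finsupp.single x c) = nsq v + 2 * (c * v x) + c * c := by
  classical
  have h1 : v.support ⊆ insert x v.support := Finset.subset_insert _ _
  have h2 : (v + Finsupp.single x c).support ⊆ insert x v.support := by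
    intro y hy
    by_contra hne
    simp only [Finset.mem_insert, not_or, Finsupp.mem_support_iff, not_not] at hne hy
    exact hy (by simp [hne.2, Finsupp.single_apply, Ne.symm hne.1])
  rw [nsq_eq _ _ h1, nsq_eq _ _ h2]
  have : ∀ i, (v + Finsupp.single x c) i ^ 2 =
      v i ^ 2 + if x = i then 2 * (c * v i) + c * c else 0 := by
    intro i
    simp only [Finsupp.add_apply, Finsupp.single_apply]
    split_ifs <;> ring
  simp only [this, Finset.sum_add_distrib, Finset.sum_ite_eq, Finset.mem_insert_self, if_true]
  ring

/-- Length of the initial run of the generator `a`. -/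
def run (a : ι) : List (ι × Bool) → ℕ
  | [] => 0
  | (b, _) :: l => if b = a then run a l + 1 else 0

theorem coc_ne_zero (a : ι) (w : List (ι × Bool)) : ∀ u : FreeGroup ι,
    coc (FreeGroup.mk w) (⟨a, (u : FreeGroup ι ⧸ _)⟩ : Idx ι) ≠ 0 →
      ∃ p, p <+: w ∧ u⁻¹ * FreeGroup.mk p ∈ Subgroup.zpowers (FreeGroup.of a) := by
  induction w with
  | nil => intro u h; exact absurd (by rw [← FreeGroup.one_eq_mk, coc_one]; rfl) h
  | cons l w ih =>
    obtain ⟨i, s⟩ := l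
    intro u h
    rw [coc_cons, Finsupp.add_apply, tr_apply] at h
    by_cases h0 : coc (FreeGroup.mk w)
        ((FreeGroup.mk [(i, s)])⁻¹ • (⟨a, (u : FreeGroup ι ⧸ _)⟩ : Idx ι)) = 0
    · rw [h0, zero_add, Finsupp.single_apply] at h
      have hb : base i = (⟨a, (u : FreeGroup ι ⧸ _)⟩ : Idx ι) := by
        by_contra hne
        exact h (if_neg hne)
      refine ⟨[], List.nil_prefix, ?_⟩
      obtain ⟨rfl, hq⟩ := Sigma.mk.inj hb
      have := QuotientGroup.eq.1 (eq_of_heq hq).symm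
      simpa [← FreeGroup.one_eq_mk] using this
    · obtain ⟨p, hp, hm⟩ := ih ((FreeGroup.mk [(i, s)])⁻¹ * u) h0
      refine ⟨(i, s) :: p, (List.prefix_cons_inj _).2 hp, ?_⟩
      rw [mk_cons]
      simpa [mul_assoc] using hm

theorem zpow_word (a : ι) (n : ℤ) : ∀ l ∈ (FreeGroup.of a ^ n).toWord, l.1 = a := by
  have hp : ∀ m : ℕ, ∀ l ∈ (FreeGroup.of a ^ m).toWord, l.1 = a := by
    intro m l hl
    rw [FreeGroup.toWord_of_pow] at hl
    rw [List.eq_of_mem_replicate hl]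
  obtain ⟨m, rfl | rfl⟩ := n.eq_nat_or_neg
  · simpa using hp m
  · intro l hl
    rw [zpow_neg, FreeGroup.toWord_inv, zpow_natCast, FreeGroup.invRev] at hl
    simp only [List.mem_reverse, List.mem_map] at hl
    obtain ⟨l', hl', rfl⟩ := hl
    exact hp m l' hl'

theorem coc_base (a : ι) (w : List (ι × Bool)) (s : Bool)
    (hw : FreeGroup.IsReduced ((a, s) :: w)) :
    coc (FreeGroup.mk w) (base a) = sg s * run a w := by
  induction w with
  | nil => rw [← FreeGroup.one_eq_mk, coc_one]; simp [run]
  | cons l w ih =>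
    obtain ⟨b, t⟩ := l
    have hw' : FreeGroup.IsReduced ((b, t) :: w) := hw.infix (List.suffix_cons _ _).isInfix
    rw [coc_cons, Finsupp.add_apply, tr_apply]
    by_cases hb : b = a
    · subst hb
      have hst : s = t := by
        have := FreeGroup.isReduced_cons_cons.1 hw
        exact this.1 rfl
      subst hst
      rw [letter_inv_smul_base, ih hw']
      simp [run]
      ring
    · have hne : base b ≠ base a := fun h => hb (congrArg Sigma.fst h)
      rw [Finsupp.single_eq_of_ne (by first | exact hne | exact hne.symm)]
      have : coc (FreeGroup.mk w) ((FreeGroup.mk [(b, t)])⁻¹ • base a) = 0 := by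
        by_contra h0
        obtain ⟨p, hp, hm⟩ := coc_ne_zero a w ((FreeGroup.mk [(b, t)])⁻¹ * 1) h0
        rw [mul_one, inv_inv, ← mk_cons] at hm
        obtain ⟨n, hn⟩ := Subgroup.mem_zpowers_iff.1 hm
        have hr : FreeGroup.IsReduced ((b, t) :: p) :=
          hw'.infix ((List.prefix_cons_inj _).2 hp).isInfix
        have := zpow_word a n (b, t) (by
          rw [hn, FreeGroup.toWord_mk, hr.reduce_eq]; simp)
        exact hb this
      rw [this]
      simp [run, hb]

/-- The squared length on words. -/
def wsq : List (ι × Bool) → ℕ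
  | [] => 0
  | (a, _) :: l => blockSqSumAux a 1 l

theorem block_run (a : ι) (w : List (ι × Bool)) : ∀ n : ℕ,
    blockSqSumAux a n w + run a w ^ 2 = (n + run a w) ^ 2 + wsq w := by
  induction w with
  | nil => intro n; simp [blockSqSumAux, run, wsq]
  | cons l w ih =>
    obtain ⟨b, t⟩ := l
    intro n
    by_cases hb : b = a
    · subst hb
      have h1 := ih (n + 1)
      have h2 := ih 1
      simp only [blockSqSumAux, run, wsq, if_true]
      nlinarith
    · simp [blockSqSumAux, run, wsq, hb]

theorem nsq_word (w : List (ι × Bool)) (hw : FreeGroup.IsReduced w) :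
    nsq (coc (FreeGroup.mk w)) = wsq w := by
  induction w with
  | nil => rw [← FreeGroup.one_eq_mk, coc_one]; simp [nsq, wsq]
  | cons l w ih =>
    obtain ⟨a, s⟩ := l
    have hw' : FreeGroup.IsReduced w := hw.infix (List.suffix_cons _ _).isInfix
    rw [coc_cons, nsq_add_single, nsq_tr, ih hw', tr_apply, letter_inv_smul_base,
      coc_base a w s hw, ← mul_assoc, sg_sq]
    have h : ((blockSqSumAux a 1 w + run a w ^ 2 : ℕ) : ℝ) =
      (((1 + run a w) ^ 2 + wsq w : ℕ) : ℝ) := congrArg _ (block_run a w 1)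
    push_cast at h
    have e : ((wsq ((a, s) :: w) : ℕ) : ℝ) = (blockSqSumAux a 1 w : ℕ) := rfl
    have e2 := sg_sq s
    have e3 : 2 * sg s * (sg s * (run a w : ℝ)) = 2 * (run a w : ℝ) := by
      linear_combination 2 * (run a w : ℝ) * e2
    rw [e, e3]
    linarith

theorem l2sq_eq (g : FreeGroup ι) : (l2sq g : ℝ) = nsq (coc g) := by
  have h := nsq_word g.toWord FreeGroup.isReduced_toWord
  rw [FreeGroup.mk_toWord] at h
  rw [h]
  unfold l2sq
  cases g.toWord <;> rfl

theorem l2sq_inv_mul (x y : FreeGroup ι) :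
    (l2sq (x⁻¹ * y) : ℝ) = nsq (coc y - coc x) := by
  have h := coc_mul x (x⁻¹ * y)
  rw [mul_inv_cancel_left] at h
  rw [h, add_sub_cancel_right, nsq_tr, l2sq_eq]

theorem l2sq_inv (x : FreeGroup ι) : (l2sq x⁻¹ : ℝ) = l2sq x := by
  have h := l2sq_inv_mul x 1
  rw [mul_one, coc_one, zero_sub] at h
  rw [h, l2sq_eq]
  simp [nsq, Finsupp.sum]

theorem exists_gram {n : ℕ} (x : Fin n → FreeGroup ι) : ∃ S : Finset (Idx ι), ∀ j k,
    (l2sq ((x j)⁻¹ * x k) : ℝ) = ∑ i ∈ S, (coc (x k) i - coc (x j) i) ^ 2 := by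
  classical
  refine ⟨Finset.univ.biUnion fun j => (coc (x j)).support, fun j k => ?_⟩
  rw [l2sq_inv_mul, nsq_eq _ (Finset.univ.biUnion fun j => (coc (x j)).support)]
  · rfl
  · intro i hi
    have := Finsupp.support_sub hi
    rw [Finset.mem_union] at this
    rw [Finset.mem_biUnion]
    rcases this with h | h
    · exact ⟨k, Finset.mem_univ _, h⟩
    · exact ⟨j, Finset.mem_univ _, h⟩

end L2Sq

/-- On the free group `F_r` on `r` generators (`r` a positive natural number or countably
infinite), the squared ℓ² length is conditionally negative definite; equivalently, for every
`0 ≤ s ≤ 1` the function `g ↦ s ^ ‖g‖₂²` is positive definite. -/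
theorem l2sq_condNegDef_and_pow_posDef
    {ι : Type*} [DecidableEq ι] [Countable ι] [Nonempty ι] :
    IsCondNegDef (fun g : FreeGroup ι => (l2sq g : ℝ)) ∧
      ∀ s : ℝ, 0 ≤ s → s ≤ 1 →
        IsPositiveDefinite (fun g : FreeGroup ι => s ^ l2sq g) := by
  refine ⟨⟨fun g => L2Sq.l2sq_inv g, fun n x c hc => ?_⟩, fun s hs hs1 n x c => ?_⟩
  · obtain ⟨S, hS⟩ := L2Sq.exists_gram x
    exact L2Sq.cnd_of_gram S (fun j i => L2Sq.coc (x j) i)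
      (fun j k => l2sq ((x j)⁻¹ * x k)) hS c hc
  · obtain ⟨S, hS⟩ := L2Sq.exists_gram x
    exact L2Sq.psd_pow S (fun j i => L2Sq.coc (x j) i)
      (fun j k => l2sq ((x j)⁻¹ * x k)) hS s hs hs1 c
end

section
/- For the free group F_r on r generators (r a positive natural number or countably infinite) and every real s with −1 ≤ s ≤ 1, the function g ↦ s^{‖g‖₂²} is positive definite on F_r. -/
open ComplexOrder

namespace FreePosDef

/-! ### Kernels -/

/-- Positive semidefinite real kernels. -/
def PSD {X : Type*} (K : X → X → ℝ) : Prop :=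
  ∀ (n : ℕ) (x : Fin n → X) (c : Fin n → ℝ), 0 ≤ ∑ i, ∑ j, c i * c j * K (x i) (x j)

lemma PSD.zero {X : Type*} : PSD (fun _ _ : X => (0 : ℝ)) := by
  intro n x c; simp

lemma PSD.add {X : Type*} {K L : X → X → ℝ} (hK : PSD K) (hL : PSD L) :
    PSD (fun x y => K x y + L x y) := by
  intro n x c
  have := add_nonneg (hK n x c) (hL n x c)
  simpa [mul_add, Finset.sum_add_distrib] using this

lemma PSD.comap {X Y : Type*} {K : X → X → ℝ} (hK : PSD K) (f : Y → X) :
    PSD (fun x y => K (f x) (f y)) := fun n x c => hK n (fun i => f (x i)) c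

lemma PSD.scale {X : Type*} {K : X → X → ℝ} (hK : PSD K) (f : X → ℝ) :
    PSD (fun x y => f x * f y * K x y) := by
  intro n x c
  have := hK n x (fun i => c i * f (x i))
  refine this.trans_eq ?_
  refine Finset.sum_congr rfl fun i _ => Finset.sum_congr rfl fun j _ => ?_
  ring

lemma PSD.one {X : Type*} : PSD (fun _ _ : X => (1 : ℝ)) := by
  intro n x c
  have : ∑ i, ∑ j, c i * c j * 1 = (∑ i, c i) * (∑ j, c j) := by
    rw [Finset.sum_mul_sum]; simp
  rw [this]; exact mul_self_nonneg _

lemma PSD.delta {X Y : Type*} [DecidableEq Y] {K : X → X → ℝ} (hK : PSD K) (g : X → Y) :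
    PSD (fun x y => if g x = g y then K x y else 0) := by
  intro n x c
  have key : ∑ i, ∑ j, c i * c j * (if g (x i) = g (x j) then K (x i) (x j) else 0)
      = ∑ v ∈ Finset.univ.image (fun i => g (x i)),
        ∑ i, ∑ j, (if g (x i) = v then c i else 0) * (if g (x j) = v then c j else 0)
          * K (x i) (x j) := by
    symm
    rw [Finset.sum_comm]
    refine Finset.sum_congr rfl fun i _ => ?_
    rw [Finset.sum_comm]
    refine Finset.sum_congr rfl fun j _ => ?_
    rw [Finset.sum_eq_single (g (x i))]
    · by_cases h : g (x i) = g (x j)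
      · simp [h]
      · simp [h, Ne.symm h]
    · intro v _ hv
      simp [Ne.symm hv]
    · intro h
      exact absurd (Finset.mem_image_of_mem _ (Finset.mem_univ i)) h
  rw [key]
  exact Finset.sum_nonneg fun v _ => hK n x _

/-- `exp (t k l) - 1` is a positive semidefinite kernel. -/
lemma PSD.expm1 (t : ℝ) (ht : 0 ≤ t) :
    PSD (fun k l : ℤ => Real.exp (t * (k * l)) - 1) := by
  intro n x c
  have h1 : ∀ u : ℝ, HasSum (fun m : ℕ => u ^ (m + 1) / ((m + 1).factorial : ℝ))
      (Real.exp u - 1) := by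
    intro u
    have h := NormedSpace.expSeries_div_hasSum_exp (𝔸 := ℝ) u
    rw [← Real.exp_eq_exp_ℝ] at h
    have := (hasSum_nat_add_iff' 1).2 h
    simpa using this
  have h2 : HasSum (fun m : ℕ => ∑ i, ∑ j, c i * c j *
      ((t * ((x i : ℝ) * (x j : ℝ))) ^ (m + 1) / ((m + 1).factorial : ℝ)))
      (∑ i, ∑ j, c i * c j * (Real.exp (t * ((x i : ℝ) * (x j : ℝ))) - 1)) := by
    refine hasSum_sum fun i _ => hasSum_sum fun j _ => ?_
    exact (h1 _).mul_left _
  refine h2.nonneg fun m => ?_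
  have : ∑ i, ∑ j, c i * c j *
      ((t * ((x i : ℝ) * (x j : ℝ))) ^ (m + 1) / ((m + 1).factorial : ℝ))
      = t ^ (m + 1) / ((m + 1).factorial : ℝ) *
        ((∑ i, c i * (x i : ℝ) ^ (m + 1)) * (∑ j, c j * (x j : ℝ) ^ (m + 1))) := by
    rw [Finset.sum_mul_sum, Finset.mul_sum]
    refine Finset.sum_congr rfl fun i _ => ?_
    rw [Finset.mul_sum]
    refine Finset.sum_congr rfl fun j _ => ?_
    rw [mul_pow, mul_pow]
    ring
  rw [this]
  exact mul_nonneg (by positivity) (mul_self_nonneg _)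

/-- The kernel on a single factor. -/
def D (s : ℝ) (k l : ℤ) : ℝ :=
  s ^ ((l - k).natAbs ^ 2) - s ^ (k.natAbs ^ 2) * s ^ (l.natAbs ^ 2)

lemma D_zero (s : ℝ) : D s 0 0 = 0 := by simp [D]

lemma psd_D (s : ℝ) (h1 : -1 ≤ s) (h2 : s ≤ 1) : PSD (D s) := by
  by_cases hs : s = 0
  · have : D s = fun k l => if k = l then
        (fun k : ℤ => if k = 0 then (0 : ℝ) else 1) k *
          (fun k : ℤ => if k = 0 then (0 : ℝ) else 1) l * 1 else 0 := by
      funext k l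
      subst hs
      simp only [D]
      by_cases h : k = l
      · subst h
        by_cases hk : k = 0
        · simp [hk]
        · simp [hk]
      · have : l - k ≠ 0 := fun h' => h (by omega)
        by_cases hk : k = 0
        · have hl : l ≠ 0 := by omega
          simp [h, hk, hl, this, Ne.symm hl]
        · simp [h, hk, this]
    rw [this]
    exact (PSD.scale PSD.one _).delta (fun k : ℤ => k)
  · have hpos : 0 < s ^ 2 := by positivity
    have hle : s ^ 2 ≤ 1 := by nlinarith
    have ht : 0 ≤ -Real.log (s ^ 2) := by
      have := Real.log_nonpos hpos.le hle
      linarith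
    have := (PSD.expm1 _ ht).scale (fun k : ℤ => s ^ (k.natAbs ^ 2))
    convert this using 1
    funext k l
    have e1 : Real.exp (-Real.log (s ^ 2) * ((k : ℝ) * l)) = s ^ (-(2 * (k * l)) : ℤ) := by
      rw [show -Real.log (s ^ 2) * ((k : ℝ) * l) = Real.log (s ^ 2) * ((-(k * l) : ℤ) : ℝ) by
        push_cast; ring]
      rw [← Real.rpow_def_of_pos hpos, Real.rpow_intCast]
      rw [show (-(2 * (k * l)) : ℤ) = (2 : ℕ) * (-(k * l)) by push_cast; ring]
      rw [zpow_mul, zpow_natCast]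
    have e2 : ∀ m : ℤ, s ^ (m.natAbs ^ 2) = s ^ (m ^ 2) := by
      intro m
      rw [← zpow_natCast]
      congr 1
      push_cast
      simp
    rw [e1, D, e2, e2, e2, mul_sub, mul_one, ← zpow_add₀ hs, ← zpow_add₀ hs]
    congr 2
    ring

/-! ### Block lists -/

section
variable {ι : Type*} [DecidableEq ι]

/-- Reduced block forms. -/
def Valid : List (ι × ℤ) → Prop
  | [] => True
  | p :: w => p.2 ≠ 0 ∧ (∀ q ∈ w.head?, p.1 ≠ q.1) ∧ Valid w

/-- Evaluation of a block list. -/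
def ev : List (ι × ℤ) → FreeGroup ι
  | [] => 1
  | p :: w => FreeGroup.of p.1 ^ p.2 * ev w

/-- Sum of squares of the exponents. -/
def wt : List (ι × ℤ) → ℕ
  | [] => 0
  | p :: w => p.2.natAbs ^ 2 + wt w

/-- The letters of a block list. -/
def letters : List (ι × ℤ) → List (ι × Bool)
  | [] => []
  | p :: w => List.replicate p.2.natAbs (p.1, decide (0 < p.2)) ++ letters w

/-- Formal `x⁻¹ y`. -/
def revApp : List (ι × ℤ) → List (ι × ℤ) → List (ι × ℤ)
  | [], y => y
  | p :: x, y => revApp x ((p.1, -p.2) :: y)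

lemma ev_revApp (x y : List (ι × ℤ)) : ev (revApp x y) = (ev x)⁻¹ * ev y := by
  induction x generalizing y with
  | nil => simp [revApp, ev]
  | cons p x ih => simp [revApp, ev, ih, mul_assoc]

lemma wt_revApp (x y : List (ι × ℤ)) : wt (revApp x y) = wt x + wt y := by
  induction x generalizing y with
  | nil => simp [revApp, wt]
  | cons p x ih => simp [revApp, wt, ih]; ring

lemma valid_revApp (x y : List (ι × ℤ)) (hx : Valid x) (hy : Valid y)
    (h : ∀ p ∈ x.head?, ∀ q ∈ y.head?, p.1 ≠ q.1) : Valid (revApp x y) := by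
  induction x generalizing y with
  | nil => simpa [revApp] using hy
  | cons p x ih =>
    refine ih _ hx.2.2 ⟨by simpa using hx.1, ?_, hy⟩ ?_
    · intro q hq
      exact h p (by simp) q hq
    · intro q hq r hr
      have := hx.2.1 q hq
      simp at hr
      subst hr
      exact this.symm

lemma mk_replicate (a : ι) (k : ℤ) :
    FreeGroup.mk (List.replicate k.natAbs (a, decide (0 < k))) = FreeGroup.of a ^ k := by
  have aux : ∀ (b : Bool) (n : ℕ), FreeGroup.mk (List.replicate n (a, b)) =
      (FreeGroup.mk [(a, b)]) ^ n := by
    intro b n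
    induction n with
    | zero => simp [FreeGroup.one_eq_mk]
    | succ n ih =>
      rw [pow_succ', ← ih, FreeGroup.mul_mk, List.replicate_succ, List.singleton_append]
  rw [aux]
  rcases lt_or_ge 0 k with h | h
  · obtain ⟨n, rfl⟩ := Int.eq_ofNat_of_zero_le h.le
    simp only [h, decide_true, Int.natAbs_natCast, zpow_natCast]
    rfl
  · obtain ⟨n, hn⟩ := Int.eq_ofNat_of_zero_le (neg_nonneg.2 h)
    obtain rfl : k = -(n : ℤ) := by omega
    have : decide (0 < -(n : ℤ)) = false := by simp
    rw [this, Int.natAbs_neg, Int.natAbs_natCast, zpow_neg, zpow_natCast, ← inv_pow]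
    congr 1

lemma mk_letters (w : List (ι × ℤ)) : FreeGroup.mk (letters w) = ev w := by
  induction w with
  | nil => simp [letters, ev, FreeGroup.one_eq_mk]
  | cons p w ih => rw [letters, ev, ← FreeGroup.mul_mk, ih, mk_replicate]

lemma head_letters (w : List (ι × ℤ)) (hw : Valid w) (a : ι)
    (h : ∀ q ∈ w.head?, a ≠ q.1) : ∀ q ∈ (letters w).head?, a ≠ q.1 := by
  cases w with
  | nil => simp [letters]
  | cons p w =>
    obtain ⟨m, hm⟩ : ∃ m, p.2.natAbs = m + 1 :=
      Nat.exists_eq_succ_of_ne_zero (by simpa using hw.1)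
    simp [letters, hm, List.replicate_succ]
    exact h p (by simp)

lemma reduced_replicate (a : ι) (b : Bool) (L : List (ι × Bool)) (hL : FreeGroup.IsReduced L)
    (h : ∀ q ∈ L.head?, a ≠ q.1) (m : ℕ) :
    FreeGroup.IsReduced (List.replicate m (a, b) ++ L) := by
  induction m with
  | zero => simpa using hL
  | succ m ih =>
    rw [List.replicate_succ, List.cons_append]
    refine List.isChain_cons.2 ⟨?_, ih⟩
    intro q hq hab
    cases m with
    | zero => exact absurd hab (h q (by simpa using hq))
    | succ m =>
      simp [List.replicate_succ] at hq
      rw [← hq]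

lemma reduced_letters (w : List (ι × ℤ)) (hw : Valid w) : FreeGroup.IsReduced (letters w) := by
  induction w with
  | nil => exact FreeGroup.IsReduced.nil
  | cons p w ih =>
    exact reduced_replicate _ _ _ (ih hw.2.2) (head_letters w hw.2.2 _ hw.2.1) _

lemma aux_replicate (a : ι) (b : Bool) (n m : ℕ) (L : List (ι × Bool)) :
    blockSqSumAux a n (List.replicate m (a, b) ++ L) = blockSqSumAux a (n + m) L := by
  induction m generalizing n with
  | zero => simp
  | succ m ih =>
    rw [List.replicate_succ, List.cons_append, blockSqSumAux, if_pos rfl, ih]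
    congr 1; ring

lemma aux_letters (w : List (ι × ℤ)) (hw : Valid w) (a : ι) (n : ℕ)
    (h : ∀ q ∈ w.head?, a ≠ q.1) : blockSqSumAux a n (letters w) = n ^ 2 + wt w := by
  induction w generalizing a n with
  | nil => simp [letters, blockSqSumAux, wt]
  | cons p w ih =>
    obtain ⟨m, hm⟩ : ∃ m, p.2.natAbs = m + 1 :=
      Nat.exists_eq_succ_of_ne_zero (by simpa using hw.1)
    have hp : a ≠ p.1 := h p (by simp)
    rw [letters, wt, hm, List.replicate_succ, List.cons_append, blockSqSumAux,
      if_neg hp.symm, aux_replicate, ih hw.2.2 _ _ hw.2.1]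
    ring

lemma l2sq_ev (w : List (ι × ℤ)) (hw : Valid w) : l2sq (ev w) = wt w := by
  have h : (ev w).toWord = letters w := by
    rw [← mk_letters, FreeGroup.toWord_mk, (reduced_letters w hw).reduce_eq]
  cases w with
  | nil => simp [l2sq, ev, wt]
  | cons p w =>
    obtain ⟨m, hm⟩ : ∃ m, p.2.natAbs = m + 1 :=
      Nat.exists_eq_succ_of_ne_zero (by simpa using hw.1)
    rw [letters, hm, List.replicate_succ, List.cons_append] at h
    rw [l2sq, h]
    simp only []
    rw [aux_replicate, aux_letters w hw.2.2 _ _ hw.2.1, wt, hm]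
    ring

lemma exists_mul (a : ι) (e : ℤ) (he : e ≠ 0) (w : List (ι × ℤ)) (hw : Valid w) :
    ∃ v, Valid v ∧ ev v = FreeGroup.of a ^ e * ev w := by
  cases w with
  | nil => exact ⟨[(a, e)], ⟨he, by simp, trivial⟩, rfl⟩
  | cons p w =>
    obtain ⟨b, k⟩ := p
    by_cases hab : a = b
    · subst hab
      by_cases hk : e + k = 0
      · refine ⟨w, hw.2.2, ?_⟩
        rw [ev, ← mul_assoc, ← zpow_add, hk]; simp
      · refine ⟨(a, e + k) :: w, ⟨hk, hw.2⟩, ?_⟩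
        rw [ev, ev, ← mul_assoc, ← zpow_add]
    · refine ⟨(a, e) :: (b, k) :: w, ⟨he, ?_, hw⟩, rfl⟩
      simpa using hab

lemma exists_ev (g : FreeGroup ι) : ∃ w, Valid w ∧ ev w = g := by
  rw [← FreeGroup.mk_toWord (x := g)]
  generalize g.toWord = L
  induction L with
  | nil => exact ⟨[], trivial, by simp [ev, FreeGroup.one_eq_mk]⟩
  | cons p L ih =>
    obtain ⟨w, hw, h⟩ := ih
    obtain ⟨a, b⟩ := p
    have e : FreeGroup.mk ((a, b) :: L) = FreeGroup.mk [(a, b)] * FreeGroup.mk L := by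
      rw [FreeGroup.mul_mk]; rfl
    rw [e, ← h]
    cases b with
    | true =>
      obtain ⟨v, hv, h'⟩ := exists_mul a 1 one_ne_zero w hw
      exact ⟨v, hv, by rw [h', zpow_one]; rfl⟩
    | false =>
      obtain ⟨v, hv, h'⟩ := exists_mul a (-1) (by norm_num) w hw
      exact ⟨v, hv, by rw [h', zpow_neg_one]; rfl⟩

/-- Name of the first generator. -/
def hd (w : List (ι × ℤ)) : Option ι := w.head?.map Prod.fst

/-- First exponent. -/
def ex : List (ι × ℤ) → ℤ
  | [] => 0
  | p :: _ => p.2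

/-- The kernel `φ(x⁻¹y) - φ(x)φ(y)`, by recursion on depth. -/
def Lk (s : ℝ) : ℕ → List (ι × ℤ) → List (ι × ℤ) → ℝ
  | 0 => fun _ _ => 0
  | n + 1 => fun x y => if hd x = hd y then
      s ^ wt x.tail * s ^ wt y.tail * D s (ex x) (ex y) +
        (if ex x = ex y then Lk s n x.tail y.tail else 0) else 0

lemma psd_Lk (s : ℝ) (h1 : -1 ≤ s) (h2 : s ≤ 1) (n : ℕ) :
    PSD (Lk (ι := ι) s n) := by
  induction n with
  | zero => exact PSD.zero
  | succ n ih =>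
    refine PSD.delta (PSD.add ?_ ?_) hd
    · exact ((psd_D s h1 h2).comap ex).scale (fun x : List (ι × ℤ) => s ^ wt x.tail)
    · exact (ih.comap List.tail).delta ex

lemma Lk_nil (s : ℝ) (n : ℕ) : Lk (ι := ι) s n [] [] = 0 := by
  induction n with
  | zero => rfl
  | succ n ih => simp [Lk, ex, D_zero, ih]

lemma kernel_eq (s : ℝ) (n : ℕ) (x y : List (ι × ℤ)) (hx : Valid x) (hy : Valid y)
    (hn : x.length ≤ n) :
    s ^ l2sq ((ev x)⁻¹ * ev y) = s ^ wt x * s ^ wt y + Lk s n x y := by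
  have sep : (∀ p ∈ x.head?, ∀ q ∈ y.head?, p.1 ≠ q.1) →
      s ^ l2sq ((ev x)⁻¹ * ev y) = s ^ wt x * s ^ wt y := by
    intro h
    rw [← ev_revApp, l2sq_ev _ (valid_revApp x y hx hy h), wt_revApp, pow_add]
  induction n generalizing x y with
  | zero =>
    obtain rfl : x = [] := by simpa using hn
    rw [sep (by simp)]
    simp [Lk]
  | succ n ih =>
    cases x with
    | nil =>
      rw [sep (by simp)]
      cases y with
      | nil => simp [Lk_nil]
      | cons q y => simp [Lk, hd]
    | cons p x =>
      cases y with
      | nil =>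
        rw [sep (by simp)]
        simp [Lk, hd]
      | cons q y =>
        obtain ⟨a, k⟩ := p
        obtain ⟨b, l⟩ := q
        by_cases hab : a = b
        · subst hab
          by_cases hkl : k = l
          · subst hkl
            have e : (ev ((a, k) :: x))⁻¹ * ev ((a, k) :: y) = (ev x)⁻¹ * ev y := by
              simp [ev, mul_assoc]
            have := ih x y hx.2.2 hy.2.2 (by simpa using hn) (by
              intro h
              rw [← ev_revApp, l2sq_ev _ (valid_revApp x y hx.2.2 hy.2.2 h), wt_revApp, pow_add])
            rw [e, this]
            simp [Lk, hd, ex, wt, D, pow_add]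
            ring
          · have e : (ev ((a, k) :: x))⁻¹ * ev ((a, l) :: y) = ev (revApp x ((a, l - k) :: y)) := by
              rw [ev_revApp]
              simp only [ev, mul_inv_rev, mul_assoc]
              rw [sub_eq_neg_add, zpow_add, zpow_neg, mul_assoc]
            have hv : Valid (revApp x ((a, l - k) :: y)) := by
              refine valid_revApp _ _ hx.2.2 ⟨?_, hy.2⟩ ?_
              · exact sub_ne_zero.2 (Ne.symm hkl)
              · intro p hp q hq
                simp at hq
                subst hq
                exact (hx.2.1 p hp).symm
            rw [e, l2sq_ev _ hv, wt_revApp]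
            simp [Lk, hd, ex, wt, D, pow_add, hkl]
            ring
        · rw [sep (by simpa using hab)]
          simp [Lk, hd, hab]

lemma wt_ev_symm (x y : List (ι × ℤ)) (s : ℝ) (hx : Valid x) (hy : Valid y) :
    s ^ l2sq ((ev x)⁻¹ * ev y) = s ^ l2sq ((ev y)⁻¹ * ev x) := by
  have hsym : ∀ n (x y : List (ι × ℤ)), Lk s n x y = Lk s n y x := by
    intro n
    induction n with
    | zero => intro x y; rfl
    | succ n ih =>
      intro x y
      have hD : D s (ex x) (ex y) = D s (ex y) (ex x) := by
        unfold D
        rw [← Int.natAbs_neg, neg_sub]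
        ring
      simp only [Lk, eq_comm (a := hd x), eq_comm (a := ex x), hD, ih x.tail]
      rw [mul_comm (s ^ wt x.tail)]
  rw [kernel_eq s (max x.length y.length) x y hx hy (le_max_left _ _),
    kernel_eq s (max x.length y.length) y x hy hx (le_max_right _ _), hsym, mul_comm (s ^ wt x)]

lemma psd_pow (s : ℝ) (h1 : -1 ≤ s) (h2 : s ≤ 1) :
    PSD (fun g h : FreeGroup ι => s ^ l2sq (g⁻¹ * h)) := by
  intro n g c
  choose w hw hg using fun i => exists_ev (g i)
  let N := Finset.univ.sup fun i => (w i).length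
  have h : PSD (fun x y : List (ι × ℤ) => s ^ wt x * s ^ wt y * 1 + Lk s N x y) :=
    (PSD.one.scale _).add (psd_Lk s h1 h2 N)
  refine (h n w c).trans_eq ?_
  refine Finset.sum_congr rfl fun i _ => Finset.sum_congr rfl fun j _ => ?_
  beta_reduce
  rw [← hg i, ← hg j, kernel_eq s N _ _ (hw i) (hw j)
    (Finset.le_sup (f := fun i => (w i).length) (Finset.mem_univ i)), mul_one]

lemma pow_symm (s : ℝ) (g h : FreeGroup ι) :
    s ^ l2sq (g⁻¹ * h) = s ^ l2sq (h⁻¹ * g) := by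
  obtain ⟨x, hx, rfl⟩ := exists_ev g
  obtain ⟨y, hy, rfl⟩ := exists_ev h
  exact wt_ev_symm x y s hx hy

end

lemma complex_of_real {n : ℕ} (M : Fin n → Fin n → ℝ) (hs : ∀ i j, M i j = M j i)
    (h : ∀ c : Fin n → ℝ, 0 ≤ ∑ i, ∑ j, c i * c j * M i j) (c : Fin n → ℂ) :
    0 ≤ ∑ j, ∑ k, c j * (starRingEnd ℂ) (c k) * (M j k : ℂ) := by
  rw [Complex.nonneg_iff]
  constructor
  · have := add_nonneg (h fun i => (c i).re) (h fun i => (c i).im)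
    refine this.trans_eq ?_
    simp only [Complex.re_sum, ← Finset.sum_add_distrib]
    refine Finset.sum_congr rfl fun i _ => Finset.sum_congr rfl fun j _ => ?_
    simp
    ring
  · simp only [Complex.im_sum]
    have e : ∀ i j, (c i * (starRingEnd ℂ) (c j) * (M i j : ℂ)).im =
        (c i).im * (c j).re * M i j - (c j).im * (c i).re * M j i := by
      intro i j
      rw [hs j i]
      simp
      ring
    simp only [e, Finset.sum_sub_distrib]
    rw [Finset.sum_comm (f := fun i j => (c j).im * (c i).re * M j i), sub_self]

end FreePosDef

/-- On the free group `F_r` on `r` generators (`r` a positive natural number or countably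
infinite), for every real `−1 ≤ s ≤ 1` the function `g ↦ s^{‖g‖₂²}` is positive definite. -/
theorem pow_l2sq_posDef
    {ι : Type*} [DecidableEq ι] [Countable ι] [Nonempty ι] :
    ∀ s : ℝ, -1 ≤ s → s ≤ 1 →
      IsPositiveDefinite (fun g : FreeGroup ι => s ^ l2sq g) := by
  intro s h1 h2 n x c
  exact FreePosDef.complex_of_real (fun j k => s ^ l2sq ((x j)⁻¹ * x k))
    (fun i j => FreePosDef.pow_symm s (x i) (x j))
    (fun c => FreePosDef.psd_pow s h1 h2 n x c) c
end

section
/- Let G be a group, S an additive commutative monoid, and θ : G → S a surjective function that is a morphism on an arbitrarily large subset of G. Let φ : G → ℝ be radial with respect to θ (φ = φ̇ ∘ θ) with φ(e) = 1. If φ is positive definite on G, then there exists a unique Radon probability measure μ on the restricted dual semigroup Ŝ such that φ(g) = ∫_{Ŝ} ρ(θ(g)) dμ(ρ) for all g ∈ G. -/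
open ComplexOrder MeasureTheory

/-- `θ : G → S` is a morphism on an arbitrarily large subset of `G`. -/
def IsMorphismOnArbLargeSubset {G S : Type*} [Group G] [AddCommMonoid S]
    (θ : G → S) : Prop :=
  ∀ (N M : ℕ) (s : Fin M → S),
    ∃ g : Fin N → Fin M → G,
      ∀ (n m : Fin N) (j k : Fin M), n ≠ m → θ ((g n j)⁻¹ * g m k) = s j + s k

/-- The restricted dual semigroup `Ŝ` of an additive commutative monoid `S`: the set of
semicharacters `ρ : S → ℝ` (`ρ(0) = 1`, `ρ(s+t) = ρ(s)ρ(t)`) with `|ρ(s)| ≤ 1` for all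
`s`, topologized by pointwise convergence. -/
def RestrictedDual (S : Type*) [AddCommMonoid S] : Type _ :=
  {ρ : S → ℝ // ρ 0 = 1 ∧ (∀ s t : S, ρ (s + t) = ρ s * ρ t) ∧ ∀ s : S, |ρ s| ≤ 1}

/-- The topology of pointwise convergence on the restricted dual semigroup. -/
instance (S : Type*) [AddCommMonoid S] : TopologicalSpace (RestrictedDual S) :=
  inferInstanceAs (TopologicalSpace {ρ : S → ℝ //
    ρ 0 = 1 ∧ (∀ s t : S, ρ (s + t) = ρ s * ρ t) ∧ ∀ s : S, |ρ s| ≤ 1})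

/-- The Borel σ-algebra on the restricted dual semigroup. -/
instance (S : Type*) [AddCommMonoid S] : MeasurableSpace (RestrictedDual S) :=
  borel (RestrictedDual S)

namespace RadialProof

set_option linter.unusedSectionVars false

variable {S : Type*} [AddCommMonoid S]

/-- Linear functional on the monoid algebra induced by a function on the monoid. -/
noncomputable def Lf (ψ : S → ℝ) : AddMonoidAlgebra ℝ S →ₗ[ℝ] ℝ where
  toFun x := x.coeff.sum fun s c => c * ψ s
  map_add' x y := by
    rw [AddMonoidAlgebra.coeff_add]
    exact Finsupp.sum_add_index' (by simp) (by intros; ring)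
  map_smul' r x := by
    rw [AddMonoidAlgebra.coeff_smul, Finsupp.sum_smul_index' (by simp)]
    simp [Finsupp.sum, Finset.mul_sum, mul_assoc]

lemma Lf_apply (ψ : S → ℝ) (x : AddMonoidAlgebra ℝ S) :
    Lf ψ x = ∑ s ∈ x.coeff.support, x.coeff s * ψ s := rfl

@[simp] lemma Lf_single (ψ : S → ℝ) (s : S) (r : ℝ) :
    Lf ψ (AddMonoidAlgebra.single s r) = r * ψ s := by
  change ((AddMonoidAlgebra.single s r).coeff).sum (fun s c => c * ψ s) = _
  rw [AddMonoidAlgebra.coeff_single]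
  exact Finsupp.sum_single_index (by simp)

lemma Lf_one (ψ : S → ℝ) : Lf ψ 1 = ψ 0 := by
  rw [AddMonoidAlgebra.one_def]; simp

lemma Lf_add (ψ χ : S → ℝ) (x : AddMonoidAlgebra ℝ S) :
    Lf (ψ + χ) x = Lf ψ x + Lf χ x := by
  simp [Lf_apply, mul_add, Finset.sum_add_distrib]

lemma Lf_smul (r : ℝ) (ψ : S → ℝ) (x : AddMonoidAlgebra ℝ S) :
    Lf (r • ψ) x = r * Lf ψ x := by
  simp only [Lf_apply, Pi.smul_apply, smul_eq_mul, Finset.mul_sum]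
  exact Finset.sum_congr rfl fun s _ => by ring

lemma Lf_shift (ψ : S → ℝ) (a : S) (x : AddMonoidAlgebra ℝ S) :
    Lf (fun s => ψ (s + a)) x = Lf ψ (AddMonoidAlgebra.single a 1 * x) := by
  induction x using AddMonoidAlgebra.induction_linear with
  | zero => simp
  | add x y hx hy => simp [mul_add, hx, hy]
  | single m r => simp [AddMonoidAlgebra.single_mul_single, add_comm]

lemma continuous_Lf (x : AddMonoidAlgebra ℝ S) : Continuous fun ψ : S → ℝ => Lf ψ x := by
  simp only [Lf_apply]; fun_prop

/-- positive definite on the monoid -/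
def PD (ψ : S → ℝ) : Prop := ∀ x : AddMonoidAlgebra ℝ S, 0 ≤ Lf ψ (x * x)

lemma exists_bound {ψ : S → ℝ} {C : ℝ} (hC : ∀ s, |ψ s| ≤ C) (y : AddMonoidAlgebra ℝ S) :
    ∃ D, ∀ b, |Lf ψ (AddMonoidAlgebra.single b 1 * y)| ≤ D := by
  induction y using AddMonoidAlgebra.induction_linear with
  | zero => exact ⟨0, by simp⟩
  | add x y hx hy =>
    obtain ⟨D, hD⟩ := hx
    obtain ⟨E, hE⟩ := hy
    refine ⟨D + E, fun b => ?_⟩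
    rw [mul_add, map_add]
    exact (abs_add_le _ _).trans (add_le_add (hD b) (hE b))
  | single m r =>
    refine ⟨|r| * C, fun b => ?_⟩
    rw [AddMonoidAlgebra.single_mul_single, Lf_single, one_mul, abs_mul]
    exact mul_le_mul_of_nonneg_left (hC _) (abs_nonneg _)

lemma cs {ψ : S → ℝ} (h : PD ψ) (b : S) (x : AddMonoidAlgebra ℝ S) :
    (Lf ψ (AddMonoidAlgebra.single b 1 * (x * x))) ^ 2 ≤
      Lf ψ (x * x) * Lf ψ (AddMonoidAlgebra.single (b + b) 1 * (x * x)) := by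
  have key : ∀ t : ℝ, 0 ≤ Lf ψ (AddMonoidAlgebra.single (b + b) 1 * (x * x)) * (t * t) +
      (2 * Lf ψ (AddMonoidAlgebra.single b 1 * (x * x))) * t + Lf ψ (x * x) := by
    intro t
    have := h (x + t • (AddMonoidAlgebra.single b 1 * x))
    have e : (x + t • (AddMonoidAlgebra.single b 1 * x)) * (x + t • (AddMonoidAlgebra.single b 1 * x))
      = x * x + (2 * t) • (AddMonoidAlgebra.single b 1 * (x * x)) +
        (t * t) • (AddMonoidAlgebra.single (b + b) 1 * (x * x)) := by
      have : (AddMonoidAlgebra.single (b + b) 1 : AddMonoidAlgebra ℝ S) =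
        AddMonoidAlgebra.single b 1 * AddMonoidAlgebra.single b 1 := by
          simp [AddMonoidAlgebra.single_mul_single]
      rw [this]
      simp only [Algebra.smul_def, map_mul, map_ofNat]
      ring
    rw [e] at this
    simp only [map_add, map_smul, smul_eq_mul] at this
    linarith
  have := discrim_le_zero key
  unfold discrim at this
  nlinarith

lemma key_bound {ψ : S → ℝ} {C : ℝ} (h : PD ψ) (hC : ∀ s, |ψ s| ≤ C)
    (a : S) (x : AddMonoidAlgebra ℝ S) :
    |Lf ψ (AddMonoidAlgebra.single a 1 * (x * x))| ≤ Lf ψ (x * x) := by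
  obtain ⟨D, hD⟩ := exists_bound hC (x * x)
  set f : S → ℝ := fun b => |Lf ψ (AddMonoidAlgebra.single b 1 * (x * x))| with hf
  have hbdd : BddAbove (Set.range f) := ⟨D, by rintro _ ⟨b, rfl⟩; exact hD b⟩
  set M := ⨆ b, f b with hM
  have hle : ∀ b, f b ≤ M := fun b => le_ciSup hbdd b
  have hA : 0 ≤ Lf ψ (x * x) := h x
  have hM0 : 0 ≤ M := (abs_nonneg _).trans (hle a)
  have h1 : ∀ b, f b ≤ Real.sqrt (Lf ψ (x * x) * M) := by
    intro b
    apply Real.abs_le_sqrt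
    exact (cs h b x).trans (mul_le_mul_of_nonneg_left ((le_abs_self _).trans (hle (b + b))) hA)
  have : Nonempty S := ⟨0⟩
  have h2 : M ≤ Real.sqrt (Lf ψ (x * x) * M) := ciSup_le h1
  have h3 : M ^ 2 ≤ Lf ψ (x * x) * M := by
    have := Real.le_sqrt hM0 (mul_nonneg hA hM0) |>.1 h2
    exact this
  refine (hle a).trans ?_
  rcases hM0.eq_or_lt with h0 | h0
  · rw [← h0]; exact hA
  · nlinarith

lemma PD.absLe {ψ : S → ℝ} {C : ℝ} (h : PD ψ) (hC : ∀ s, |ψ s| ≤ C) (s : S) :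
    |ψ s| ≤ ψ 0 := by
  have := key_bound h hC s 1
  simpa [Lf_one] using this

lemma PD.shift {ψ : S → ℝ} {C : ℝ} (h : PD ψ) (hC : ∀ s, |ψ s| ≤ C) (a : S) {ε : ℝ}
    (hε : |ε| = 1) : PD (ψ + ε • fun s => ψ (s + a)) := by
  intro x
  rw [Lf_add, Lf_smul, Lf_shift]
  have h1 := key_bound h hC a x
  have : |ε * Lf ψ (AddMonoidAlgebra.single a 1 * (x * x))| ≤ Lf ψ (x * x) := by
    rwa [abs_mul, hε, one_mul]
  linarith [(abs_le.1 this).1]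

/-- The compact convex set of normalized positive definite functions. -/
def K (S : Type*) [AddCommMonoid S] : Set (S → ℝ) :=
  {ψ | ψ 0 = 1 ∧ PD ψ ∧ ∀ s, |ψ s| ≤ 1}

lemma isCompact_K : IsCompact (K S) := by
  have h1 : IsCompact (Set.univ.pi fun _ : S => Set.Icc (-1 : ℝ) 1) :=
    isCompact_univ_pi fun _ => isCompact_Icc
  refine h1.of_isClosed_subset ?_ ?_
  · have : K S = {ψ : S → ℝ | ψ 0 = 1} ∩ (⋂ x : AddMonoidAlgebra ℝ S, {ψ | 0 ≤ Lf ψ (x * x)}) ∩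
        ⋂ s, {ψ : S → ℝ | |ψ s| ≤ 1} := by
      ext ψ; simp [K, PD, and_assoc]
    rw [this]
    refine ((isClosed_eq (by fun_prop) (by fun_prop)).inter ?_).inter ?_
    · exact isClosed_iInter fun x => isClosed_le continuous_const (continuous_Lf _)
    · exact isClosed_iInter fun s => isClosed_le (by fun_prop) continuous_const
  · intro ψ hψ s _
    exact abs_le.1 (hψ.2.2 s)

/-- normalised shifted function lies in K -/
lemma mem_K_shift {ψ : S → ℝ} (h : ψ ∈ K S) (a : S) {ε : ℝ} (hε : |ε| = 1)
    (hpos : 0 < 1 + ε * ψ a) :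
    (1 + ε * ψ a)⁻¹ • (ψ + ε • fun s => ψ (s + a)) ∈ K S := by
  have hPD := h.2.1.shift h.2.2 a hε
  have hb : ∀ s, |(ψ + ε • fun s => ψ (s + a)) s| ≤ 2 := by
    intro s
    simp only [Pi.add_apply, Pi.smul_apply, smul_eq_mul]
    refine (abs_add_le _ _).trans ?_
    rw [abs_mul, hε]
    linarith [h.2.2 s, h.2.2 (s + a)]
  have h0 : (ψ + ε • fun s => ψ (s + a)) 0 = 1 + ε * ψ a := by simp [h.1]
  refine ⟨?_, ?_, ?_⟩
  · rw [Pi.smul_apply, h0, smul_eq_mul, inv_mul_cancel₀ hpos.ne']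
  · intro x
    rw [Lf_smul]
    exact mul_nonneg (inv_nonneg.2 hpos.le) (hPD x)
  · intro s
    have := hPD.absLe hb s
    rw [h0] at this
    rw [Pi.smul_apply, smul_eq_mul, abs_mul, abs_of_pos (inv_pos.2 hpos)]
    rw [inv_mul_le_iff₀ hpos]; linarith

lemma shift_eq_zero {ψ : S → ℝ} (h : ψ ∈ K S) (a : S) {ε : ℝ} (hε : |ε| = 1)
    (hz : 1 + ε * ψ a = 0) (s : S) : ψ s + ε * ψ (s + a) = 0 := by
  have hPD := h.2.1.shift h.2.2 a hε
  have hb : ∀ s, |(ψ + ε • fun s => ψ (s + a)) s| ≤ 2 := by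
    intro s
    simp only [Pi.add_apply, Pi.smul_apply, smul_eq_mul]
    refine (abs_add_le _ _).trans ?_
    rw [abs_mul, hε]
    linarith [h.2.2 s, h.2.2 (s + a)]
  have := hPD.absLe hb s
  simp only [Pi.add_apply, Pi.smul_apply, smul_eq_mul, zero_add, h.1, hz] at this
  exact abs_nonpos_iff.1 this

lemma mul_of_extreme {ψ : S → ℝ} (h : ψ ∈ (K S).extremePoints ℝ) (s a : S) :
    ψ (s + a) = ψ s * ψ a := by
  have hK := h.1
  have ha := abs_le.1 (hK.2.2 a)
  have e1 : |(1 : ℝ)| = 1 := by simp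
  have e2 : |(-1 : ℝ)| = 1 := by simp
  rcases ha.1.eq_or_lt with h1 | h1
  · have := shift_eq_zero hK a e1 (by rw [← h1]; ring) s
    rw [← h1]; linarith
  rcases ha.2.eq_or_lt with h2 | h2
  · have := shift_eq_zero hK a e2 (by rw [h2]; ring) s
    rw [h2]; linarith
  have p1 : 0 < 1 + 1 * ψ a := by linarith
  have p2 : 0 < 1 + (-1) * ψ a := by linarith
  have m1 := mem_K_shift hK a e1 p1
  have m2 := mem_K_shift hK a e2 p2
  have := h.2 m1 m2 ?_
  · have h3 := congrFun this s
    simp only [Pi.smul_apply, Pi.add_apply, smul_eq_mul] at h3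
    rw [inv_mul_eq_iff_eq_mul₀ p1.ne'] at h3
    linarith
  · refine ⟨(1 + 1 * ψ a) / 2, (1 + (-1) * ψ a) / 2, by linarith, by linarith, by ring, ?_⟩
    ext t
    simp only [Pi.smul_apply, Pi.add_apply, smul_eq_mul]
    have q1 : (1 + 1 * ψ a) * (1 + 1 * ψ a)⁻¹ = 1 := mul_inv_cancel₀ p1.ne'
    have q2 : (1 + -1 * ψ a) * (1 + -1 * ψ a)⁻¹ = 1 := mul_inv_cancel₀ p2.ne'
    linear_combination (ψ t + 1 * ψ (t + a)) / 2 * q1 + (ψ t + -1 * ψ (t + a)) / 2 * q2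

lemma Lf_nonneg {ψ : S → ℝ} (h : ψ ∈ K S) (x : AddMonoidAlgebra ℝ S)
    (hx : ∀ ρ : RestrictedDual S, 0 ≤ Lf ρ.1 x) : 0 ≤ Lf ψ x := by
  let l : (S → ℝ) →L[ℝ] ℝ :=
    { toFun := fun χ => - Lf χ x
      map_add' := fun a b => by rw [Lf_add]; ring
      map_smul' := fun r a => by rw [Lf_smul]; simp
      cont := (continuous_Lf x).neg }
  have hE : IsExposed ℝ (K S) {y ∈ K S | ∀ z ∈ K S, l z ≤ l y} := fun _ => ⟨l, rfl⟩
  obtain ⟨z, hzA, hz⟩ := isCompact_K.exists_isMaxOn ⟨ψ, h⟩ l.continuous.continuousOn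
  obtain ⟨y, hy⟩ := (hE.isCompact isCompact_K).extremePoints_nonempty ⟨z, hzA, hz⟩
  have hyK := hE.isExtreme.extremePoints_subset_extremePoints hy
  have h1 : - Lf ψ x ≤ - Lf y x := hy.1.2 ψ h
  have h2 := hx ⟨y, hyK.1.1, fun s t => mul_of_extreme hyK s t, hyK.1.2.2⟩
  change 0 ≤ Lf y x at h2
  linarith

end RadialProof

namespace RadialProof

variable {S : Type*} [AddCommMonoid S]

instance instT2 : T2Space (RestrictedDual S) :=
  inferInstanceAs (T2Space {ρ : S → ℝ //
    ρ 0 = 1 ∧ (∀ s t : S, ρ (s + t) = ρ s * ρ t) ∧ ∀ s : S, |ρ s| ≤ 1})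

instance instBorel : BorelSpace (RestrictedDual S) := ⟨rfl⟩

lemma continuous_val : Continuous fun ρ : RestrictedDual S => ρ.1 := continuous_subtype_val

instance instCompact : CompactSpace (RestrictedDual S) := by
  have h : IsCompact {ρ : S → ℝ |
      ρ 0 = 1 ∧ (∀ s t : S, ρ (s + t) = ρ s * ρ t) ∧ ∀ s : S, |ρ s| ≤ 1} := by
    have h1 : IsCompact (Set.univ.pi fun _ : S => Set.Icc (-1 : ℝ) 1) :=
      isCompact_univ_pi fun _ => isCompact_Icc
    refine h1.of_isClosed_subset ?_ ?_
    · have : {ρ : S → ℝ | ρ 0 = 1 ∧ (∀ s t : S, ρ (s + t) = ρ s * ρ t) ∧ ∀ s : S, |ρ s| ≤ 1} =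
        {ψ : S → ℝ | ψ 0 = 1} ∩ ((⋂ s, ⋂ t, {ψ | ψ (s + t) = ψ s * ψ t}) ∩
        ⋂ s, {ψ : S → ℝ | |ψ s| ≤ 1}) := by
        ext ψ; simp
      rw [this]
      refine (isClosed_eq (by fun_prop) (by fun_prop)).inter (IsClosed.inter ?_ ?_)
      · exact isClosed_iInter fun s => isClosed_iInter fun t =>
          isClosed_eq (by fun_prop) (by fun_prop)
      · exact isClosed_iInter fun s => isClosed_le (by fun_prop) continuous_const
    · intro ψ hψ s _
      exact abs_le.1 (hψ.2.2 s)
  exact isCompact_iff_compactSpace.1 h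

/-- Evaluation functions as continuous functions. -/
noncomputable def ev (s : S) : C(RestrictedDual S, ℝ) :=
  ⟨fun ρ => ρ.1 s, (continuous_apply s).comp continuous_val⟩

/-- The algebra homomorphism into continuous functions. -/
noncomputable def J : AddMonoidAlgebra ℝ S →ₐ[ℝ] C(RestrictedDual S, ℝ) :=
  AddMonoidAlgebra.lift ℝ C(RestrictedDual S, ℝ) S
    { toFun := fun s => ev s.toAdd
      map_one' := by ext ρ; exact ρ.2.1
      map_mul' := fun s t => by ext ρ; exact ρ.2.2.1 _ _ }

lemma J_single (s : S) (r : ℝ) : J (AddMonoidAlgebra.single s r) = r • ev s := by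
  simp [J]

lemma J_apply (x : AddMonoidAlgebra ℝ S) (ρ : RestrictedDual S) : J x ρ = Lf ρ.1 x := by
  induction x using AddMonoidAlgebra.induction_linear with
  | zero => simp
  | add x y hx hy => simp [hx, hy]
  | single m r => rw [J_single, Lf_single]; rfl

lemma range_J_dense : (J (S := S)).range.topologicalClosure = ⊤ := by
  apply ContinuousMap.subalgebra_topologicalClosure_eq_top_of_separatesPoints
  intro ρ σ hne
  have : ∃ s, ρ.1 s ≠ σ.1 s := by
    by_contra hc
    push Not at hc
    exact hne (Subtype.ext (funext hc))
  obtain ⟨s, hs⟩ := this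
  refine ⟨ev s, ⟨ev s, ⟨AddMonoidAlgebra.single s 1, by simp [J_single]⟩, rfl⟩, hs⟩

lemma integrable_cont (μ : Measure (RestrictedDual S)) [IsFiniteMeasure μ]
    (f : C(RestrictedDual S, ℝ)) : Integrable f μ :=
  f.continuous.integrable_of_hasCompactSupport (HasCompactSupport.of_compactSpace _)

lemma unique_measure (μ ν : Measure (RestrictedDual S)) [IsFiniteMeasure μ] [IsFiniteMeasure ν]
    [μ.Regular] [ν.Regular] (h : ∀ s, ∫ ρ, ev s ρ ∂μ = ∫ ρ, ev s ρ ∂ν) : μ = ν := by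
  have hJ : ∀ x : AddMonoidAlgebra ℝ S, ∫ ρ, J x ρ ∂μ = ∫ ρ, J x ρ ∂ν := by
    intro x
    induction x using AddMonoidAlgebra.induction_linear with
    | zero => simp
    | add x y hx hy =>
      simp only [map_add, ContinuousMap.add_apply]
      rw [integral_add (integrable_cont _ _) (integrable_cont _ _),
        integral_add (integrable_cont _ _) (integrable_cont _ _), hx, hy]
    | single m r =>
      simp only [J_single, ContinuousMap.smul_apply, integral_smul, h]
  have hcont : ∀ (μ : Measure (RestrictedDual S)) [IsFiniteMeasure μ],
      Continuous fun f : C(RestrictedDual S, ℝ) => ∫ ρ, f ρ ∂μ := by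
    intro μ _
    let l : C(RestrictedDual S, ℝ) →ₗ[ℝ] ℝ :=
      { toFun := fun f => ∫ ρ, f ρ ∂μ
        map_add' := fun f g => integral_add (integrable_cont _ f) (integrable_cont _ g)
        map_smul' := fun r f => integral_smul r _ }
    refine (l.mkContinuous (μ.real Set.univ) fun f => ?_).continuous
    refine (norm_integral_le_of_norm_le_const
      (Filter.Eventually.of_forall fun ρ => f.norm_coe_le_norm ρ)).trans_eq ?_
    ring
  have hall : ∀ f : C(RestrictedDual S, ℝ), ∫ ρ, f ρ ∂μ = ∫ ρ, f ρ ∂ν := by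
    intro f
    have hf : f ∈ closure ((J (S := S)).range : Set C(RestrictedDual S, ℝ)) := by
      rw [← Subalgebra.topologicalClosure_coe, range_J_dense]; trivial
    have hcl : IsClosed {f : C(RestrictedDual S, ℝ) | ∫ ρ, f ρ ∂μ = ∫ ρ, f ρ ∂ν} :=
      isClosed_eq (hcont μ) (hcont ν)
    refine closure_minimal ?_ hcl hf
    rintro _ ⟨x, rfl⟩
    exact hJ x
  exact Measure.ext_of_integral_eq_on_compactlySupported fun f => hall f.toContinuousMap

lemma exists_measure {ψ : S → ℝ} (h : ψ ∈ K S) :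
    ∃ μ : Measure (RestrictedDual S), IsProbabilityMeasure μ ∧ μ.Regular ∧
      ∀ s, ψ s = ∫ ρ, ρ.1 s ∂μ := by
  have hker : LinearMap.ker (J (S := S)).toLinearMap ≤ LinearMap.ker (Lf ψ) := by
    intro x hx
    have hx' : J x = 0 := hx
    have hz : ∀ ρ : RestrictedDual S, Lf ρ.1 x = 0 := fun ρ => by rw [← J_apply, hx']; rfl
    refine le_antisymm ?_ (Lf_nonneg h x fun ρ => (hz ρ).ge)
    have := Lf_nonneg h (-x) fun ρ => by rw [map_neg, hz ρ, neg_zero]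
    rw [map_neg] at this
    linarith
  let f : C(RestrictedDual S, ℝ) →ₗ.[ℝ] ℝ :=
    { domain := LinearMap.range (J (S := S)).toLinearMap
      toFun := ((LinearMap.ker (J (S := S)).toLinearMap).liftQ (Lf ψ) hker) ∘ₗ
        ((J (S := S)).toLinearMap.quotKerEquivRange.symm : _ →ₗ[ℝ] _) }
  have hf : ∀ (x : AddMonoidAlgebra ℝ S) (hx : J x ∈ f.domain), f ⟨J x, hx⟩ = Lf ψ x := by
    intro x hx
    change ((LinearMap.ker (J (S := S)).toLinearMap).liftQ (Lf ψ) hker)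
      ((J (S := S)).toLinearMap.quotKerEquivRange.symm ⟨J x, hx⟩) = _
    have := LinearMap.quotKerEquivRange_symm_apply_image (J (S := S)).toLinearMap x hx
    erw [this]
    exact Submodule.liftQ_apply _ _ _
  let P : PointedCone ℝ C(RestrictedDual S, ℝ) :=
    { carrier := {f | ∀ ρ, 0 ≤ f ρ}
      add_mem' := fun {a b} ha hb ρ => add_nonneg (ha ρ) (hb ρ)
      zero_mem' := fun ρ => le_rfl
      smul_mem' := fun c a ha ρ => mul_nonneg c.2 (ha ρ) }
  obtain ⟨g, hg1, hg2⟩ := riesz_extension P f (by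
      rintro ⟨_, x, rfl⟩ hx
      have h2 := hf x ⟨x, rfl⟩
      change 0 ≤ f ⟨J x, ⟨x, rfl⟩⟩
      rw [h2]
      exact Lf_nonneg h x fun ρ => by rw [← J_apply]; exact hx ρ) (by
      intro y
      refine ⟨⟨J (AddMonoidAlgebra.single 0 ‖y‖), ⟨_, rfl⟩⟩, fun ρ => ?_⟩
      have h1 : J (AddMonoidAlgebra.single 0 ‖y‖) ρ = ‖y‖ := by
        rw [J_apply, Lf_single, ρ.2.1, mul_one]
      have h2 := (abs_le.1 (y.norm_coe_le_norm ρ)).1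
      change 0 ≤ J (AddMonoidAlgebra.single 0 ‖y‖) ρ + y ρ
      rw [h1]; linarith)
  have hgJ : ∀ x, g (J x) = Lf ψ x := fun x => by
    exact (hg1 ⟨J x, ⟨x, rfl⟩⟩).trans (hf x ⟨x, rfl⟩)
  let Λ : CompactlySupportedContinuousMap (RestrictedDual S) ℝ →ₚ[ℝ] ℝ :=
    { toFun := fun u => g u.toContinuousMap
      map_add' := fun u v => map_add g u.toContinuousMap v.toContinuousMap
      map_smul' := fun r u => map_smul g r u.toContinuousMap
      monotone' := fun u v huv => by
        have := hg2 (v.toContinuousMap - u.toContinuousMap) fun ρ => sub_nonneg.2 (huv ρ)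
        rw [map_sub] at this
        exact sub_nonneg.1 this }
  have hint : ∀ s, ψ s = ∫ ρ, ρ.1 s ∂(RealRMK.rieszMeasure Λ) := by
    intro s
    have h1 := RealRMK.integral_rieszMeasure Λ
      ⟨ev s, HasCompactSupport.of_compactSpace _⟩
    have h2 : g (ev s) = ψ s := by
      have := hgJ (AddMonoidAlgebra.single s 1)
      rwa [J_single, one_smul, Lf_single, one_mul] at this
    rw [← h2]
    exact h1.symm
  refine ⟨RealRMK.rieszMeasure Λ, ⟨?_⟩, inferInstance, hint⟩
  have h0 := hint 0
  have : ∀ ρ : RestrictedDual S, ρ.1 0 = 1 := fun ρ => ρ.2.1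
  simp only [this, h.1, integral_const, smul_eq_mul, mul_one] at h0
  rw [measureReal_def] at h0
  exact (ENNReal.toReal_eq_one_iff _).1 h0.symm

end RadialProof

namespace RadialProof

lemma symm_and_bound {G : Type*} [Group G] {φ : G → ℝ} (hone : φ 1 = 1)
    (hφ : IsPositiveDefinite φ) (g : G) : |φ g| ≤ 1 := by
  have h1 := hφ 2 ![1, g] ![1, 1]
  have h2 := hφ 2 ![1, g] ![1, -1]
  have h3 := hφ 2 ![1, g] ![1, Complex.I]
  simp only [Fin.sum_univ_two, Complex.le_def] at h1 h2 h3
  simp [hone] at h1 h2 h3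
  rw [abs_le]
  constructor <;> linarith

lemma real_form {G : Type*} [Group G] {φ : G → ℝ} (hφ : IsPositiveDefinite φ)
    {ι : Type*} [Fintype ι] (x : ι → G) (c : ι → ℝ) :
    0 ≤ ∑ j, ∑ k, c j * c k * φ ((x j)⁻¹ * x k) := by
  let e := Fintype.equivFin ι
  have h := hφ (Fintype.card ι) (x ∘ e.symm) (fun i => (c (e.symm i) : ℂ))
  have h2 : ∑ j, ∑ k, c j * c k * φ ((x j)⁻¹ * x k) =
      ∑ j, ∑ k, c (e.symm j) * c (e.symm k) * φ ((x (e.symm j))⁻¹ * x (e.symm k)) := by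
    rw [← e.symm.sum_comp]
    refine Finset.sum_congr rfl fun j _ => ?_
    rw [← e.symm.sum_comp]
  rw [h2]
  simp only [Complex.conj_ofReal, Function.comp] at h
  exact_mod_cast h

lemma form_nonneg {G S : Type*} [Group G] [AddCommMonoid S]
    {θ : G → S} (hmor : IsMorphismOnArbLargeSubset θ)
    {φ : G → ℝ} {ψ : S → ℝ} (hrad : ∀ g : G, φ g = ψ (θ g))
    (hone : φ 1 = 1) (hφ : IsPositiveDefinite φ) {M : ℕ} (s : Fin M → S) (c : Fin M → ℝ) :
    0 ≤ ∑ j, ∑ k, c j * c k * ψ (s j + s k) := by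
  set Q := ∑ j, ∑ k, c j * c k * ψ (s j + s k) with hQ
  set C := ∑ j, ∑ k, |c j * c k| with hC
  have main : ∀ N : ℕ, 0 ≤ (N : ℝ) * (C + (N - 1) * Q) := by
    intro N
    obtain ⟨g, hg⟩ := hmor N M s
    have h := real_form hφ (ι := Fin N × Fin M) (fun p => g p.1 p.2) (fun p => c p.2)
    simp only [Fintype.sum_prod_type] at h
    refine h.trans ?_
    have step : ∀ n : Fin N, ∑ j, ∑ m, ∑ k, c j * c k * φ ((g n j)⁻¹ * g m k) ≤
        C + (N - 1) * Q := by
      intro n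
      rw [Finset.sum_comm, ← Finset.add_sum_erase _ _ (Finset.mem_univ n)]
      apply add_le_add
      · refine Finset.sum_le_sum fun j _ => Finset.sum_le_sum fun k _ => ?_
        refine (le_abs_self _).trans ?_
        rw [abs_mul]
        exact mul_le_of_le_one_right (abs_nonneg _) (symm_and_bound hone hφ _)
      · have : ∀ m ∈ Finset.univ.erase n,
            ∑ j, ∑ k, c j * c k * φ ((g n j)⁻¹ * g m k) = Q := by
          intro m hm
          have hne : n ≠ m := (Finset.ne_of_mem_erase hm).symm
          refine Finset.sum_congr rfl fun j _ => Finset.sum_congr rfl fun k _ => ?_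
          rw [hrad, hg n m j k hne]
        rw [Finset.sum_congr rfl this, Finset.sum_const, Finset.card_erase_of_mem (Finset.mem_univ n)]
        have hN : 1 ≤ N := by have := n.2; omega
        simp [Nat.cast_sub hN]
    refine (Finset.sum_le_sum fun n _ => step n).trans ?_
    rw [Finset.sum_const, Finset.card_univ, Fintype.card_fin, nsmul_eq_mul]
  by_contra hneg
  push Not at hneg
  obtain ⟨n, hn⟩ := exists_nat_gt (C / (-Q))
  have h1 := main (n + 1)
  have hp : (0 : ℝ) < ((n + 1 : ℕ) : ℝ) := by positivity
  have h2 := nonneg_of_mul_nonneg_right h1 hp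
  rw [div_lt_iff₀ (by linarith)] at hn
  push_cast at h2
  linarith

lemma Lf_mul_self {S : Type*} [AddCommMonoid S] (ψ : S → ℝ) (x : AddMonoidAlgebra ℝ S) :
    Lf ψ (x * x) = ∑ s ∈ x.coeff.support, ∑ t ∈ x.coeff.support,
      x.coeff s * x.coeff t * ψ (s + t) := by
  have hx : x = ∑ s ∈ x.coeff.support, AddMonoidAlgebra.single s (x.coeff s) := by
    conv_lhs => rw [← AddMonoidAlgebra.sum_coeff_single x]
    rfl
  conv_lhs => rw [hx]
  rw [Finset.sum_mul_sum, map_sum]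
  refine Finset.sum_congr rfl fun s _ => ?_
  rw [map_sum]
  refine Finset.sum_congr rfl fun t _ => ?_
  rw [AddMonoidAlgebra.single_mul_single, Lf_single]

lemma mem_K {G S : Type*} [Group G] [AddCommMonoid S]
    {θ : G → S} (hsurj : Function.Surjective θ) (hmor : IsMorphismOnArbLargeSubset θ)
    {φ : G → ℝ} {ψ : S → ℝ} (hrad : ∀ g : G, φ g = ψ (θ g))
    (hone : φ 1 = 1) (hφ : IsPositiveDefinite φ) : ψ ∈ K S := by
  have hb : ∀ s, |ψ s| ≤ 1 := by
    intro s
    obtain ⟨g, rfl⟩ := hsurj s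
    rw [← hrad]
    exact symm_and_bound hone hφ g
  have hPD : PD ψ := by
    intro x
    rw [Lf_mul_self]
    let e := x.coeff.support.equivFin
    have h := form_nonneg hmor hrad hone hφ (fun i => ((e.symm i : x.coeff.support) : S))
      (fun i => x.coeff (e.symm i : x.coeff.support))
    have h2 : ∑ s ∈ x.coeff.support, ∑ t ∈ x.coeff.support, x.coeff s * x.coeff t * ψ (s + t) =
        ∑ s : x.coeff.support, ∑ t : x.coeff.support, x.coeff s * x.coeff t * ψ (s + t) := by
      rw [← Finset.sum_coe_sort]
      refine Finset.sum_congr rfl fun s _ => ?_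
      rw [← Finset.sum_coe_sort]
    rw [h2, ← e.symm.sum_comp]
    refine h.trans_eq (Finset.sum_congr rfl fun s _ => ?_)
    rw [← e.symm.sum_comp]
  refine ⟨le_antisymm (abs_le.1 (hb 0)).2 ?_, hPD, hb⟩
  have := hPD.absLe hb (θ 1)
  rw [← hrad, hone, abs_one] at this
  exact this

end RadialProof

/-- Let `θ : G → S` be a surjective morphism on an arbitrarily large subset of `G` into an
additive commutative monoid, and let `φ = φ̇ ∘ θ` be radial with `φ(e) = 1`. If `φ` is
positive definite on `G`, then there is a unique Radon (regular) probability measure `μ` on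
the restricted dual semigroup `Ŝ` with `φ(g) = ∫_{Ŝ} ρ(θ(g)) dμ(ρ)` for all `g`. -/
theorem exists_unique_measure_of_posDef_radial
    {G S : Type*} [Group G] [AddCommMonoid S]
    (θ : G → S) (hsurj : Function.Surjective θ)
    (hmor : IsMorphismOnArbLargeSubset θ)
    (φ : G → ℝ) (φdot : S → ℝ) (hrad : ∀ g : G, φ g = φdot (θ g))
    (hone : φ 1 = 1) (hφ : IsPositiveDefinite φ) :
    ∃! μ : Measure (RestrictedDual S),
      (IsProbabilityMeasure μ ∧ μ.Regular) ∧
        ∀ g : G, φ g = ∫ ρ : RestrictedDual S, ρ.1 (θ g) ∂μ := by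
  obtain ⟨μ, h1, h2, h3⟩ := RadialProof.exists_measure
    (RadialProof.mem_K hsurj hmor hrad hone hφ)
  refine ⟨μ, ⟨⟨h1, h2⟩, fun g => by rw [hrad, h3]⟩, ?_⟩
  rintro ν ⟨⟨n1, n2⟩, n3⟩
  refine RadialProof.unique_measure ν μ fun s => ?_
  obtain ⟨g, rfl⟩ := hsurj s
  have e1 := n3 g
  rw [hrad, h3] at e1
  exact e1.symm
end

section
/- Let F_∞ be the free group on countably infinitely many generators and let φ : F_∞ → ℝ be radial with respect to the ℓ² length (i.e., φ(g) depends only on ‖g‖₂²) with φ(e) = 1. Then φ is positive definite on F_∞ if and only if there exists a probability measure μ on [−1, 1] such that φ(g) = ∫_{−1}^{1} s^{‖g‖₂²} dμ(s) for all g ∈ F_∞; moreover, when such a μ exists it is uniquely determined by φ. -/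
open ComplexOrder

open MeasureTheory

def PSDK {α : Type*} (K : α → α → ℝ) : Prop :=
  ∀ (n : ℕ) (x : Fin n → α) (c : Fin n → ℝ), 0 ≤ ∑ j, ∑ k, c j * c k * K (x j) (x k)

namespace PSDK
variable {α β : Type*} {K K' : α → α → ℝ}

theorem add (h : PSDK K) (h' : PSDK K') : PSDK (fun x y => K x y + K' x y) := by
  intro n x c
  have := add_nonneg (h n x c) (h' n x c)
  simpa [mul_add, Finset.sum_add_distrib] using this

theorem zero : PSDK (fun _ _ : α => (0 : ℝ)) := by
  intro n x c; simp

theorem one : PSDK (fun _ _ : α => (1 : ℝ)) := by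
  intro n x c
  have : ∑ j, ∑ k, c j * c k * (1 : ℝ) = (∑ j, c j) * (∑ k, c k) := by
    simp [Finset.sum_mul_sum]
  rw [this]; exact mul_self_nonneg _

theorem smul (h : PSDK K) (f : α → ℝ) : PSDK (fun x y => f x * f y * K x y) := by
  intro n x c
  have := h n x (fun j => c j * f (x j))
  refine this.trans_eq (Finset.sum_congr rfl fun j _ => Finset.sum_congr rfl fun k _ => ?_)
  ring

theorem comap (h : PSDK K) (f : β → α) : PSDK (fun x y => K (f x) (f y)) :=
  fun n x c => h n (fun j => f (x j)) c

theorem const_mul (h : PSDK K) {r : ℝ} (hr : 0 ≤ r) : PSDK (fun x y => r * K x y) := by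
  have := h.smul (fun _ => √r)
  simpa [Real.mul_self_sqrt hr] using this

theorem ind [DecidableEq β] (h : PSDK K) (f : α → β) :
    PSDK (fun x y => if f x = f y then K x y else 0) := by
  intro n x c
  let s : Finset β := Finset.univ.image (fun j => f (x j))
  have key : ∑ j, ∑ k, c j * c k * (if f (x j) = f (x k) then K (x j) (x k) else 0)
      = ∑ v ∈ s, ∑ j, ∑ k, (if f (x j) = v then c j else 0) * (if f (x k) = v then c k else 0)
          * K (x j) (x k) := by
    rw [Finset.sum_comm (s := s)]
    refine Finset.sum_congr rfl fun j _ => ?_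
    rw [Finset.sum_comm (s := s)]
    refine Finset.sum_congr rfl fun k _ => ?_
    rw [Finset.sum_eq_single (f (x j))]
    · by_cases hh : f (x j) = f (x k)
      · simp [hh]
      · simp [hh, Ne.symm hh]
    · intro b _ hb
      simp [Ne.symm hb]
    · intro hn
      exact absurd (Finset.mem_image_of_mem (fun j => f (x j)) (Finset.mem_univ j)) hn
  rw [key]
  exact Finset.sum_nonneg fun v _ => h n x _

theorem sum {ι : Type*} (s : Finset ι) {F : ι → α → α → ℝ} (h : ∀ i ∈ s, PSDK (F i)) :
    PSDK (fun x y => ∑ i ∈ s, F i x y) := by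
  classical
  induction s using Finset.induction_on with
  | empty => simpa using zero
  | insert a s ha ih =>
    simp only [Finset.sum_insert ha]
    exact (h a (by simp)).add (ih fun i hi => h i (by simp [hi]))

theorem lim {F : ℕ → α → α → ℝ} (h : ∀ i, PSDK (F i))
    (ht : ∀ x y, Filter.Tendsto (fun i => F i x y) Filter.atTop (nhds (K x y))) : PSDK K := by
  intro n x c
  refine ge_of_tendsto' (f := fun i => ∑ j, ∑ k, c j * c k * F i (x j) (x k)) (x := Filter.atTop) ?_
    (fun i => h i n x c)
  exact tendsto_finsetSum _ fun j _ => tendsto_finsetSum _ fun k _ => (ht _ _).const_mul _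

theorem expm1 {t : ℝ} (ht : 0 ≤ t) :
    PSDK (fun i j : ℤ => Real.exp (t * (i * j)) - 1) := by
  refine lim (F := fun N i j => ∑ n ∈ Finset.range N, (t ^ (n + 1) / (n + 1).factorial) *
    ((i : ℝ) ^ (n + 1) * (j : ℝ) ^ (n + 1) * 1)) (fun N => sum _ fun n _ => ?_) ?_
  · exact ((one (α := ℤ)).smul (fun i : ℤ => (i : ℝ) ^ (n + 1))).const_mul (by positivity)
  · intro i j
    have h := (NormedSpace.expSeries_div_hasSum_exp (t * ((i : ℝ) * j)))
    rw [← Real.exp_eq_exp_ℝ] at h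
    have h2 := (hasSum_nat_add_iff' 1).mpr h
    simp only [Finset.range_one, Finset.sum_singleton, pow_zero, Nat.factorial_zero, Nat.cast_one,
      div_one] at h2
    convert h2.tendsto_sum_nat using 3 with N n hn
    rw [mul_pow, mul_pow]; ring

theorem intKer {s : ℝ} (h1 : -1 ≤ s) (h2 : s ≤ 1) :
    PSDK (fun i j : ℤ => s ^ ((j - i).natAbs ^ 2) - s ^ (i.natAbs ^ 2) * s ^ (j.natAbs ^ 2)) := by
  by_cases hs : s = 0
  · subst hs
    have h : PSDK (fun i j : ℤ => if i = j then (if i = 0 then (0:ℝ) else 1) *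
      (if j = 0 then (0:ℝ) else 1) * 1 else 0) :=
      ((one (α := ℤ)).smul (fun i : ℤ => if i = 0 then (0:ℝ) else 1)).ind (fun i : ℤ => i)
    convert h using 3 with i j
    by_cases hij : i = j
    · subst hij; by_cases h0 : i = 0 <;> simp [h0]
    · have : (j - i).natAbs ≠ 0 := by omega
      by_cases h0 : i = 0
      · have : j.natAbs ≠ 0 := by omega
        simp_all
      · simp_all
  · have hpos : 0 < |s| := abs_pos.mpr hs
    have hle : |s| ≤ 1 := abs_le.mpr ⟨h1, h2⟩
    set t := -Real.log |s| with htdef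
    have ht : 0 ≤ t := by
      have := Real.log_nonpos hpos.le hle
      linarith
    have hst : |s| = Real.exp (-t) := by rw [htdef, neg_neg, Real.exp_log hpos]
    have key := (expm1 (t := 2 * t) (by linarith)).smul (fun i : ℤ => s ^ (i.natAbs ^ 2))
    convert key using 3 with i j
    have e1 : s ^ ((j - i).natAbs ^ 2)
        = s ^ (i.natAbs ^ 2) * s ^ (j.natAbs ^ 2) * Real.exp (2 * t * (i * j)) := by
      have habs : |s| ^ ((j - i).natAbs ^ 2)
        = |s| ^ (i.natAbs ^ 2) * |s| ^ (j.natAbs ^ 2) * Real.exp (2 * t * (i * j)) := by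
        rw [hst]
        rw [← Real.exp_nat_mul, ← Real.exp_nat_mul, ← Real.exp_nat_mul, ← Real.exp_add,
          ← Real.exp_add]
        congr 1
        have hc : ∀ z : ℤ, ((z.natAbs ^ 2 : ℕ) : ℝ) = (z : ℝ) ^ 2 := by
          intro z
          have : ((z.natAbs ^ 2 : ℕ) : ℤ) = z ^ 2 := by simp
          have h3 := congrArg (Int.cast : ℤ → ℝ) this
          rwa [Int.cast_natCast, Int.cast_pow] at h3
        rw [hc, hc, hc]; push_cast; ring
      rcases abs_choice s with h | h
      · rw [h] at habs; exact habs
      · rw [h] at habs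
        have hp : (-1 : ℝ) ^ ((j - i).natAbs ^ 2)
          = (-1) ^ (i.natAbs ^ 2) * (-1) ^ (j.natAbs ^ 2) := by
          rw [← pow_add]
          apply neg_one_pow_congr
          simp only [Nat.even_add, Nat.even_pow, Int.natAbs_even, Int.even_sub]
          tauto
        rw [neg_pow, hp, neg_pow s (i.natAbs ^ 2), neg_pow s (j.natAbs ^ 2)] at habs
        have hu : ((-1 : ℝ) ^ (i.natAbs ^ 2) * (-1) ^ (j.natAbs ^ 2)) ≠ 0 := by 
          exact mul_ne_zero (pow_ne_zero _ (by norm_num)) (pow_ne_zero _ (by norm_num))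
        apply mul_left_cancel₀ hu
        linear_combination habs
    rw [e1]; ring
end PSDK
/-- block product -/
def bprod (X : List (ℕ × ℤ)) : FreeGroup ℕ := (X.map fun p => FreeGroup.of p.1 ^ p.2).prod

def bred (X : List (ℕ × ℤ)) : Prop :=
  X.IsChain (fun p q => p.1 ≠ q.1) ∧ ∀ p ∈ X, p.2 ≠ 0

def bsq (X : List (ℕ × ℤ)) : ℕ := (X.map fun p => p.2.natAbs ^ 2).sum

def blet (p : ℕ × ℤ) : List (ℕ × Bool) := List.replicate p.2.natAbs (p.1, decide (0 < p.2))

def bword (X : List (ℕ × ℤ)) : List (ℕ × Bool) := X.flatMap blet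

theorem bprod_cons (p : ℕ × ℤ) (X) : bprod (p :: X) = FreeGroup.of p.1 ^ p.2 * bprod X := by
  simp [bprod]

theorem bsq_cons (p : ℕ × ℤ) (X) : bsq (p :: X) = p.2.natAbs ^ 2 + bsq X := by
  simp [bsq]

theorem bred_tail {p : ℕ × ℤ} {X} (h : bred (p :: X)) : bred X :=
  ⟨h.1.of_cons, fun q hq => h.2 q (List.mem_cons_of_mem _ hq)⟩

theorem mk_blet (p : ℕ × ℤ) : FreeGroup.mk (blet p) = FreeGroup.of p.1 ^ p.2 := by
  obtain ⟨a, k⟩ := p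
  have h1 : ∀ n : ℕ, FreeGroup.mk (List.replicate n (a, true)) = FreeGroup.of a ^ n := by
    intro n
    rw [← FreeGroup.toWord_of_pow, FreeGroup.mk_toWord]
  have h2 : ∀ n : ℕ, FreeGroup.mk (List.replicate n (a, false)) = (FreeGroup.of a ^ n)⁻¹ := by
    intro n
    rw [← h1, FreeGroup.inv_mk]
    simp [FreeGroup.invRev]
  rcases lt_or_ge 0 k with hk | hk
  · obtain ⟨n, rfl⟩ := Int.eq_ofNat_of_zero_le hk.le
    simp only [blet, hk, decide_true, h1]; simp
  · obtain ⟨n, rfl⟩ := Int.exists_eq_neg_ofNat hk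
    have : ¬ (0 < -(n : ℤ)) := by omega
    simp only [blet, this, decide_false, h2]; simp

theorem mk_bword (X) : FreeGroup.mk (bword X) = bprod X := by
  induction X with
  | nil => rfl
  | cons p X ih =>
    rw [bprod_cons, ← ih, ← mk_blet, FreeGroup.mul_mk]; rfl

theorem blet_cons {p : ℕ × ℤ} (h : p.2 ≠ 0) :
    blet p = (p.1, decide (0 < p.2)) :: List.replicate (p.2.natAbs - 1) (p.1, decide (0 < p.2)) := by
  have : p.2.natAbs = (p.2.natAbs - 1) + 1 := by omega
  rw [blet, this, List.replicate_succ]; simp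

theorem isReduced_bword {X} (h : bred X) : FreeGroup.IsReduced (bword X) := by
  induction X with
  | nil => exact FreeGroup.IsReduced.nil
  | cons p X ih =>
    have hX := ih (bred_tail h)
    show List.IsChain _ (blet p ++ bword X)
    rw [List.isChain_append]
    refine ⟨?_, hX, ?_⟩
    · exact List.isChain_replicate_of_rel _ (by simp)
    · intro x hx y hy
      have hx' : x = (p.1, decide (0 < p.2)) := by
        have := List.mem_of_mem_getLast? hx
        exact List.eq_of_mem_replicate this
      cases X with
      | nil => simp [bword] at hy
      | cons q X =>
        have hq : q.2 ≠ 0 := h.2 q (by simp)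
        have hpq := (List.isChain_cons_cons.mp h.1).1
        simp only [bword, List.flatMap_cons, blet_cons hq] at hy
        simp at hy
        subst hx' hy
        intro he; exact absurd he hpq

theorem aux_replicate (a : ℕ) (b : Bool) (l) (m n : ℕ) :
    blockSqSumAux a n (List.replicate m (a, b) ++ l) = blockSqSumAux a (n + m) l := by
  induction m generalizing n with
  | zero => simp
  | succ m ih =>
    rw [List.replicate_succ, List.cons_append]
    simp only [blockSqSumAux, if_true]
    rw [ih]; congr 1; omega

theorem aux_bword (X) (hX : bred X) (a n) (ha : ∀ q ∈ X.head?, a ≠ q.1) :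
    blockSqSumAux a n (bword X) = n ^ 2 + bsq X := by
  induction X generalizing a n with
  | nil => simp [bword, bsq, blockSqSumAux]
  | cons q X ih =>
    have hq : q.2 ≠ 0 := hX.2 q (by simp)
    have hne : q.1 ≠ a := fun h => ha q (by simp) h.symm
    have : bword (q :: X) = blet q ++ bword X := rfl
    rw [this, blet_cons hq, List.cons_append]
    simp only [blockSqSumAux, if_neg hne]
    rw [aux_replicate, ih (bred_tail hX), bsq_cons]
    · have : 1 + (q.2.natAbs - 1) = q.2.natAbs := by omega
      rw [this]
    · intro r hr
      cases X with
      | nil => simp at hr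
      | cons r' X =>
        simp at hr; subst hr
        exact (List.isChain_cons_cons.mp hX.1).1

theorem l2sq_bprod {X} (hX : bred X) : l2sq (bprod X) = bsq X := by
  have hw : (bprod X).toWord = bword X := by
    rw [← mk_bword, FreeGroup.toWord_mk, (isReduced_bword hX).reduce_eq]
  cases X with
  | nil => simp [l2sq, bprod, bsq]
  | cons q X =>
    have hq : q.2 ≠ 0 := hX.2 q (by simp)
    have h1 : bword (q :: X) = blet q ++ bword X := rfl
    rw [h1, blet_cons hq, List.cons_append] at hw
    unfold l2sq
    rw [hw]
    simp only
    rw [aux_replicate, aux_bword _ (bred_tail hX), bsq_cons]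
    · have : 1 + (q.2.natAbs - 1) = q.2.natAbs := by omega
      rw [this]
    · intro r hr
      cases X with
      | nil => simp at hr
      | cons r' X =>
        simp at hr; subst hr
        exact (List.isChain_cons_cons.mp hX.1).1

theorem bred_cons {p : ℕ × ℤ} {X} (hX : bred X) (hp : p.2 ≠ 0) (h : ∀ q ∈ X.head?, p.1 ≠ q.1) :
    bred (p :: X) := by
  refine ⟨List.isChain_cons.mpr ⟨h, hX.1⟩, ?_⟩
  intro q hq
  rcases List.mem_cons.mp hq with rfl | hq
  · exact hp
  · exact hX.2 q hq

theorem head_ne {p : ℕ × ℤ} {X} (h : bred (p :: X)) : ∀ q ∈ X.head?, p.1 ≠ q.1 :=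
  (List.isChain_cons.mp h.1).1

theorem exists_bred_mul (a : ℕ) (e : ℤ) (he : e ≠ 0) (X) (hX : bred X) :
    ∃ Y, bred Y ∧ bprod Y = FreeGroup.of a ^ e * bprod X := by
  cases X with
  | nil => exact ⟨[(a, e)], bred_cons hX he (by simp), bprod_cons _ _⟩
  | cons p X =>
    obtain ⟨b, k⟩ := p
    by_cases hab : a = b
    · subst hab
      by_cases hk : e + k = 0
      · refine ⟨X, bred_tail hX, ?_⟩
        rw [bprod_cons, ← mul_assoc, ← zpow_add, hk]; simp
      · refine ⟨(a, e + k) :: X, bred_cons (bred_tail hX) hk (fun q hq => head_ne hX q hq), ?_⟩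
        rw [bprod_cons, bprod_cons, ← mul_assoc, ← zpow_add]
    · exact ⟨(a, e) :: (b, k) :: X, bred_cons hX he (by simpa using hab), bprod_cons _ _⟩

theorem exists_bred (g : FreeGroup ℕ) : ∃ X, bred X ∧ bprod X = g := by
  have : ∀ L : List (ℕ × Bool), ∃ X, bred X ∧ bprod X = FreeGroup.mk L := by
    intro L
    induction L with
    | nil => exact ⟨[], ⟨List.isChain_nil, by simp⟩, rfl⟩
    | cons p L ih =>
      obtain ⟨X, hX, hX'⟩ := ih
      obtain ⟨a, b⟩ := p
      have hc : FreeGroup.mk ((a, b) :: L) = FreeGroup.mk [(a, b)] * FreeGroup.mk L := by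
        rw [FreeGroup.mul_mk]; rfl
      rw [hc, ← hX']
      cases b
      · have : FreeGroup.mk [(a, false)] = FreeGroup.of a ^ (-1 : ℤ) := by
          rw [zpow_neg_one]; rfl
        rw [this]; exact exists_bred_mul a (-1) (by norm_num) X hX
      · have : FreeGroup.mk [(a, true)] = FreeGroup.of a ^ (1 : ℤ) := by
          rw [zpow_one]; rfl
        rw [this]; exact exists_bred_mul a 1 (by norm_num) X hX
  obtain ⟨X, h⟩ := this g.toWord
  rw [FreeGroup.mk_toWord] at h
  exact ⟨X, h⟩

/-- inverse block list -/
def binv (X : List (ℕ × ℤ)) : List (ℕ × ℤ) := (X.map fun p => (p.1, -p.2)).reverse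

theorem bprod_append (X Y) : bprod (X ++ Y) = bprod X * bprod Y := by simp [bprod]

theorem bsq_append (X Y) : bsq (X ++ Y) = bsq X + bsq Y := by simp [bsq]

theorem bprod_binv (X) : bprod (binv X) = (bprod X)⁻¹ := by
  induction X with
  | nil => simp [binv, bprod]
  | cons p X ih =>
    have : binv (p :: X) = binv X ++ [(p.1, -p.2)] := by simp [binv]
    rw [this, bprod_append, ih, bprod_cons p X, mul_inv_rev]; simp [bprod]

theorem bsq_binv (X) : bsq (binv X) = bsq X := by
  induction X with
  | nil => simp [binv]
  | cons p X ih =>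
    have : binv (p :: X) = binv X ++ [(p.1, -p.2)] := by simp [binv]
    rw [this, bsq_append, ih, bsq_cons]; simp [bsq, add_comm]

theorem bred_binv {X} (h : bred X) : bred (binv X) := by
  refine ⟨?_, ?_⟩
  · rw [binv, List.isChain_reverse, List.isChain_map]
    exact h.1.imp fun a b hab => by simpa [flip] using hab.symm
  · intro p hp
    simp [binv] at hp
    obtain ⟨a, b, hab, rfl⟩ := hp
    simpa using h.2 _ hab

theorem bred_inv_append {X Y} (hX : bred X) (hY : bred Y)
    (h : ∀ p ∈ X.head?, ∀ q ∈ Y.head?, p.1 ≠ q.1) : bred (binv X ++ Y) := by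
  refine ⟨List.isChain_append.mpr ⟨(bred_binv hX).1, hY.1, ?_⟩, ?_⟩
  · intro x hx y hy
    simp [binv] at hx
    obtain ⟨b, k, hb, rfl⟩ := hx
    exact h _ hb y hy
  · intro p hp
    rcases List.mem_append.mp hp with hp | hp
    · exact (bred_binv hX).2 p hp
    · exact hY.2 p hp

theorem l2sq_inv_mul {X Y} (hX : bred X) (hY : bred Y)
    (h : ∀ p ∈ X.head?, ∀ q ∈ Y.head?, p.1 ≠ q.1) :
    l2sq ((bprod X)⁻¹ * bprod Y) = bsq X + bsq Y := by
  rw [← bprod_binv, ← bprod_append, l2sq_bprod (bred_inv_append hX hY h), bsq_append, bsq_binv]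

theorem l2sq_inv_mul_same {a : ℕ} {i j : ℤ} {X Y} (hX : bred ((a, i) :: X))
    (hY : bred ((a, j) :: Y)) (hij : i ≠ j) :
    l2sq ((bprod ((a, i) :: X))⁻¹ * bprod ((a, j) :: Y)) = bsq X + (j - i).natAbs ^ 2 + bsq Y := by
  have e : (bprod ((a, i) :: X))⁻¹ * bprod ((a, j) :: Y)
      = (bprod X)⁻¹ * bprod ((a, j - i) :: Y) := by
    rw [bprod_cons, bprod_cons, bprod_cons, mul_inv_rev, zpow_sub]
    simp only
    rw [(Commute.refl (FreeGroup.of a)).zpow_zpow j i |>.inv_right |>.eq]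
    group
  rw [e, l2sq_inv_mul (bred_tail hX), bsq_cons, add_assoc]
  · exact bred_cons (bred_tail hY) (by simp; omega) (fun q hq => head_ne hY q hq)
  · intro p hp q hq
    simp at hq; subst hq
    exact (head_ne hX p hp).symm

theorem l2sq_inv_mul_cancel {p : ℕ × ℤ} {X Y} :
    (bprod (p :: X))⁻¹ * bprod (p :: Y) = (bprod X)⁻¹ * bprod Y := by
  rw [bprod_cons, bprod_cons]; group

theorem bred_nil : bred [] := ⟨List.isChain_nil, by simp⟩

theorem l2sq_one : l2sq (1 : FreeGroup ℕ) = 0 := by simp [l2sq]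

theorem l2sq_inv (g : FreeGroup ℕ) : l2sq g⁻¹ = l2sq g := by
  obtain ⟨X, hX, rfl⟩ := exists_bred g
  rw [← bprod_binv, l2sq_bprod (bred_binv hX), bsq_binv, l2sq_bprod hX]

noncomputable def hdz (X : List (ℕ × ℤ)) : ℤ := (X.head?.map Prod.snd).getD 0

noncomputable def kap (s : ℝ) : ℕ → List (ℕ × ℤ) → List (ℕ × ℤ) → ℝ
  | 0, _, _ => 0
  | N + 1, X, Y => (if X.head? = Y.head? then kap s N X.tail Y.tail else 0) +
      (if X.head?.map Prod.fst = Y.head?.map Prod.fst then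
        s ^ bsq X.tail * s ^ bsq Y.tail * (s ^ ((hdz Y - hdz X).natAbs ^ 2)
          - s ^ ((hdz X).natAbs ^ 2) * s ^ ((hdz Y).natAbs ^ 2)) else 0)

theorem kap_psd {s : ℝ} (h1 : -1 ≤ s) (h2 : s ≤ 1) (N : ℕ) : PSDK (kap s N) := by
  induction N with
  | zero => exact PSDK.zero
  | succ N ih =>
    have e1 := (ih.comap (List.tail)).ind (fun X : List (ℕ × ℤ) => X.head?)
    have e2 := (((PSDK.intKer h1 h2).comap hdz).smul
      (fun X : List (ℕ × ℤ) => s ^ bsq X.tail)).ind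
        (fun X : List (ℕ × ℤ) => X.head?.map Prod.fst)
    exact e1.add e2

theorem kap_nil (s : ℝ) (N : ℕ) : kap s N [] [] = 0 := by
  induction N with
  | zero => rfl
  | succ N ih => simp [kap, ih, hdz]

theorem kap_eq (s : ℝ) (N : ℕ) (X Y) (hX : bred X) (hY : bred Y) (hN : X.length ≤ N) :
    s ^ l2sq ((bprod X)⁻¹ * bprod Y) = kap s N X Y + s ^ bsq X * s ^ bsq Y := by
  induction N generalizing X Y with
  | zero =>
    have : X = [] := List.length_eq_zero_iff.mp (by omega)
    subst this
    rw [l2sq_inv_mul hX hY (by simp), pow_add]; simp [kap]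
  | succ N ih =>
    rcases X with _ | ⟨⟨a, i⟩, X⟩
    · rw [l2sq_inv_mul hX hY (by simp), pow_add]
      rcases Y with _ | ⟨⟨b, j⟩, Y⟩
      · simp [kap_nil]
      · simp [kap]
    · rcases Y with _ | ⟨⟨b, j⟩, Y⟩
      · rw [l2sq_inv_mul hX hY (by simp), pow_add]; simp [kap]
      · by_cases hab : a = b
        · subst hab
          by_cases hij : i = j
          · subst hij
            rw [l2sq_inv_mul_cancel, ih X Y (bred_tail hX) (bred_tail hY) (by simpa using hN)]
            simp [kap, hdz, bsq_cons, pow_add]; ring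
          · rw [l2sq_inv_mul_same hX hY hij]
            simp [kap, hdz, bsq_cons, pow_add, hij]; ring
        · rw [l2sq_inv_mul hX hY (by simpa using hab), pow_add]; simp [kap, hab]

theorem psd_pow {s : ℝ} (h1 : -1 ≤ s) (h2 : s ≤ 1) :
    PSDK (fun x y : FreeGroup ℕ => s ^ l2sq (x⁻¹ * y)) := by
  intro n x c
  choose X hX hX' using fun j => exists_bred (x j)
  let N := ∑ j, (X j).length
  have hN : ∀ j, (X j).length ≤ N := fun j =>
    Finset.single_le_sum (f := fun j => (X j).length) (fun _ _ => Nat.zero_le _) (Finset.mem_univ j)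
  have := ((kap_psd h1 h2 N).add
    ((PSDK.one (α := List (ℕ × ℤ))).smul (fun X => s ^ bsq X))) n X c
  refine this.trans_eq (Finset.sum_congr rfl fun j _ => Finset.sum_congr rfl fun k _ => ?_)
  rw [← hX' j, ← hX' k]
  simp only
  rw [kap_eq s N _ _ (hX j) (hX k) (hN j), mul_one]

theorem posdef_of_psdk {φ : FreeGroup ℕ → ℝ} (hs : ∀ g, φ g⁻¹ = φ g)
    (h : PSDK (fun x y : FreeGroup ℕ => φ (x⁻¹ * y))) : IsPositiveDefinite φ := by
  intro n x c
  rw [Complex.nonneg_iff]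
  constructor
  · have := add_nonneg (h n x (fun j => (c j).re)) (h n x (fun j => (c j).im))
    refine this.trans_eq ?_
    simp only [Complex.re_sum, ← Finset.sum_add_distrib]
    refine Finset.sum_congr rfl fun j _ => Finset.sum_congr rfl fun k _ => ?_
    simp; ring
  · have : ∀ S : ℝ, S = -S → 0 = S := fun S h => by linarith
    apply this
    simp only [Complex.im_sum]
    conv_rhs => rw [Finset.sum_comm]
    simp only [← Finset.sum_neg_distrib]
    refine Finset.sum_congr rfl fun j _ => Finset.sum_congr rfl fun k _ => ?_
    have : φ ((x k)⁻¹ * x j) = φ ((x j)⁻¹ * x k) := by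
      rw [← hs]; congr 1; group
    rw [this]
    simp; ring

theorem posdef_of_moment {φ : FreeGroup ℕ → ℝ} (μ : Measure (Set.Icc (-1 : ℝ) 1))
    [IsProbabilityMeasure μ]
    (h : ∀ g : FreeGroup ℕ, φ g = ∫ s : Set.Icc (-1 : ℝ) 1, (s : ℝ) ^ l2sq g ∂μ) :
    IsPositiveDefinite φ := by
  apply posdef_of_psdk
  · intro g; rw [h, h, l2sq_inv]
  · intro n x c
    have hint : ∀ m : ℕ, Integrable (fun s : Set.Icc (-1 : ℝ) 1 => (s : ℝ) ^ m) μ := fun m =>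
      Continuous.integrable_of_hasCompactSupport (by fun_prop) (HasCompactSupport.of_compactSpace _)
    have : ∑ j, ∑ k, c j * c k * φ ((x j)⁻¹ * x k)
      = ∫ s : Set.Icc (-1 : ℝ) 1, ∑ j, ∑ k, c j * c k * (s : ℝ) ^ l2sq ((x j)⁻¹ * x k) ∂μ := by
      rw [integral_finsetSum _ fun j _ => integrable_finsetSum _ fun k _ => (hint _).const_mul _]
      refine Finset.sum_congr rfl fun j _ => ?_
      rw [integral_finsetSum _ fun k _ => (hint _).const_mul _]
      refine Finset.sum_congr rfl fun k _ => ?_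
      rw [integral_const_mul, h]
    rw [this]
    exact integral_nonneg fun s => psd_pow s.2.1 s.2.2 n x c

/-- alternating words -/
def xw (α j : ℕ) : List (ℕ × ℤ) := (List.range j).map fun i => (Nat.pair α i, 1)

theorem bred_xw (α j : ℕ) : bred (xw α j) := by
  refine ⟨?_, ?_⟩
  · rw [xw, List.isChain_map]
    refine List.Pairwise.isChain ?_
    refine List.pairwise_lt_range.imp ?_
    intro a b hab h
    have := (Nat.pair_eq_pair.mp h).2
    omega
  · intro p hp
    simp [xw] at hp
    obtain ⟨i, _, rfl⟩ := hp
    simp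

theorem bsq_xw (α j : ℕ) : bsq (xw α j) = j := by
  simp [bsq, xw, Function.comp_def]

theorem l2sq_xw_ne {α β : ℕ} (h : α ≠ β) (j k : ℕ) :
    l2sq ((bprod (xw α j))⁻¹ * bprod (xw β k)) = j + k := by
  rw [l2sq_inv_mul (bred_xw _ _) (bred_xw _ _), bsq_xw, bsq_xw]
  intro p hp q hq he
  have hp := List.mem_of_mem_head? hp
  have hq := List.mem_of_mem_head? hq
  simp [xw] at hp hq
  obtain ⟨i, _, rfl⟩ := hp
  obtain ⟨i', _, rfl⟩ := hq
  exact h (Nat.pair_eq_pair.mp he).1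

theorem exists_l2sq (n : ℕ) : ∃ g : FreeGroup ℕ, l2sq g = n :=
  ⟨bprod (xw 0 n), by rw [l2sq_bprod (bred_xw _ _), bsq_xw]⟩

theorem psdk_of_posdef {φ : FreeGroup ℕ → ℝ} (h : IsPositiveDefinite φ) :
    PSDK (fun x y : FreeGroup ℕ => φ (x⁻¹ * y)) := by
  intro n x c
  have := h n x (fun j => (c j : ℂ))
  simp only [Complex.conj_ofReal] at this
  exact_mod_cast this

theorem abs_le_one {φ : FreeGroup ℕ → ℝ} (h : IsPositiveDefinite φ) (hs : ∀ g, φ g⁻¹ = φ g)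
    (h1 : φ 1 = 1) (g) : |φ g| ≤ 1 := by
  have a := psdk_of_posdef h 2 ![1, g] ![1, 1]
  have b := psdk_of_posdef h 2 ![1, g] ![1, -1]
  simp [Fin.sum_univ_two, hs, h1] at a b
  rw [abs_le]; constructor <;> linarith

theorem PSDK.fintype {α : Type*} {K : α → α → ℝ} (h : PSDK K) {ι : Type*} [Fintype ι]
    (x : ι → α) (c : ι → ℝ) : 0 ≤ ∑ j, ∑ k, c j * c k * K (x j) (x k) := by
  let e := Fintype.equivFin ι
  refine (h _ (x ∘ e.symm) (c ∘ e.symm)).trans_eq ?_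
  rw [← e.symm.sum_comp]
  refine Finset.sum_congr rfl fun j _ => ?_
  rw [← e.symm.sum_comp]; rfl

theorem hankel {φ : FreeGroup ℕ → ℝ} (h : IsPositiveDefinite φ) (m : ℕ → ℝ)
    (hm : ∀ g, φ g = m (l2sq g)) (h1 : φ 1 = 1) (n : ℕ) (c : Fin n → ℝ) :
    0 ≤ ∑ j, ∑ k, c j * c k * m (j + k) := by
  set H := ∑ j, ∑ k, c j * c k * m (j + k) with hH
  have hs : ∀ g, φ g⁻¹ = φ g := fun g => by rw [hm, hm, l2sq_inv]
  let C : ℝ := ∑ j, ∑ k, |c j * c k|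
  have hC : 0 ≤ C := Finset.sum_nonneg fun j _ => Finset.sum_nonneg fun k _ => abs_nonneg _
  let F : ℕ → ℕ → ℝ := fun α β =>
    ∑ j : Fin n, ∑ k : Fin n, c j * c k * φ ((bprod (xw α j))⁻¹ * bprod (xw β k))
  have hF1 : ∀ α β, α ≠ β → F α β = H := by
    intro α β hab
    refine Finset.sum_congr rfl fun j _ => Finset.sum_congr rfl fun k _ => ?_
    rw [hm, l2sq_xw_ne hab]
  have hF2 : ∀ α, F α α ≤ C := by
    intro α
    refine Finset.sum_le_sum fun j _ => Finset.sum_le_sum fun k _ => ?_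
    refine (le_abs_self _).trans ?_
    rw [abs_mul]
    exact mul_le_of_le_one_right (abs_nonneg _) (abs_le_one h hs h1 _)
  have key : ∀ N : ℕ, 0 ≤ ∑ α ∈ Finset.range N, ∑ β ∈ Finset.range N, F α β := by
    intro N
    have := (psdk_of_posdef h).fintype (ι := Fin N × Fin n)
      (fun p => bprod (xw p.1 p.2)) (fun p => c p.2)
    refine this.trans_eq ?_
    rw [Finset.sum_range, Fintype.sum_prod_type]
    refine Finset.sum_congr rfl fun α _ => ?_
    rw [Finset.sum_range]
    simp only [Fintype.sum_prod_type]
    rw [Finset.sum_comm]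
  have key2 : ∀ N : ℕ, 0 ≤ N * (C - H) + N * N * H := by
    intro N
    refine (key N).trans ?_
    have : ∀ α ∈ Finset.range N, ∑ β ∈ Finset.range N, F α β ≤ (C - H) + N * H := by
      intro α hα
      have : ∀ β ∈ Finset.range N, F α β ≤ (if α = β then C - H else 0) + H := by
        intro β _
        by_cases hab : α = β
        · subst hab; simpa using hF2 α
        · simp [hab, hF1 α β hab]
      refine (Finset.sum_le_sum this).trans_eq ?_
      rw [Finset.sum_add_distrib, Finset.sum_ite_eq]
      simp [Finset.mem_range.mp hα]
    refine (Finset.sum_le_sum this).trans_eq ?_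
    simp; ring
  by_contra hneg
  push Not at hneg
  obtain ⟨N, hN⟩ := exists_nat_gt ((C - H) / (-H))
  rw [div_lt_iff₀ (by linarith)] at hN
  have hN0 : (0 : ℝ) < N := by
    by_contra h0
    have : (N : ℝ) = 0 := le_antisymm (not_lt.mp h0) (Nat.cast_nonneg N)
    rw [this] at hN; linarith
  have := key2 N
  nlinarith
section Moment
open Polynomial

def GoodF (L : ℝ[X] →ₗ[ℝ] ℝ) : Prop :=
  (∀ q : ℝ[X], 0 ≤ L (q * q)) ∧ ∀ q : ℝ[X], ∃ C : ℝ, ∀ n : ℕ, |L (X ^ n * q)| ≤ C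

theorem convex_bdd_le {a : ℕ → ℝ} (hc : ∀ n, 0 ≤ a (n + 2) - 2 * a (n + 1) + a n) {C : ℝ}
    (hb : ∀ n, |a n| ≤ C) : a 1 ≤ a 0 := by
  by_contra h
  push Not at h
  have h1 : ∀ n, a 1 - a 0 ≤ a (n + 1) - a n := by
    intro n
    induction n with
    | zero => simp
    | succ n ih => have := hc n; linarith
  have h2 : ∀ n : ℕ, a 0 + n * (a 1 - a 0) ≤ a n := by
    intro n
    induction n with
    | zero => simp
    | succ n ih => have := h1 n; push_cast; linarith
  obtain ⟨N, hN⟩ := exists_nat_gt ((C - a 0) / (a 1 - a 0))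
  rw [div_lt_iff₀ (by linarith)] at hN
  have := h2 N
  have := (abs_le.mp (hb N)).2
  linarith

theorem GoodF.one_sub_sq {L : ℝ[X] →ₗ[ℝ] ℝ} (h : GoodF L) (q : ℝ[X]) :
    0 ≤ L ((1 - X ^ 2) * (q * q)) := by
  obtain ⟨C, hC⟩ := h.2 (q * q)
  have := convex_bdd_le (a := fun n => L (X ^ (2 * n) * (q * q))) (C := C) ?_ (fun n => hC _)
  · have e : (1 - X ^ 2) * (q * q) = X ^ (2 * 0) * (q * q) - X ^ (2 * 1) * (q * q) := by ring
    rw [e, map_sub]; linarith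
  · intro n
    have := h.1 (X ^ n * (1 - X ^ 2) * q)
    have e : X ^ n * (1 - X ^ 2) * q * (X ^ n * (1 - X ^ 2) * q) = X ^ (2 * (n + 2)) * (q * q)
      - ((2 : ℝ) • (X ^ (2 * (n + 1)) * (q * q))) + X ^ (2 * n) * (q * q) := by
      rw [two_smul]; ring
    rw [e] at this
    simpa using this

theorem GoodF.mul {L : ℝ[X] →ₗ[ℝ] ℝ} (h : GoodF L) (f : ℝ[X])
    (hf : ∀ q : ℝ[X], 0 ≤ L (f * (q * q))) : GoodF (L.comp (LinearMap.mulLeft ℝ f)) := by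
  refine ⟨fun q => by simpa using hf q, fun q => ?_⟩
  obtain ⟨C, hC⟩ := h.2 (f * q)
  refine ⟨C, fun n => ?_⟩
  have e : f * (X ^ n * q) = X ^ n * (f * q) := by ring
  simpa [e] using hC n

theorem GoodF.one_sub {L : ℝ[X] →ₗ[ℝ] ℝ} (h : GoodF L) (q : ℝ[X]) :
    0 ≤ L ((1 - X) * (q * q)) := by
  have h1 := h.1 ((1 - X) * q)
  have h2 := h.one_sub_sq q
  have e : (2 : ℝ) • ((1 - X) * (q * q)) = (1 - X) * q * ((1 - X) * q) + (1 - X ^ 2) * (q * q) := by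
    rw [two_smul]; ring
  have e2 := congrArg L e
  rw [map_smul, map_add, smul_eq_mul] at e2
  linarith

theorem GoodF.one_add {L : ℝ[X] →ₗ[ℝ] ℝ} (h : GoodF L) (q : ℝ[X]) :
    0 ≤ L ((1 + X) * (q * q)) := by
  have h1 := h.1 ((1 + X) * q)
  have h2 := h.one_sub_sq q
  have e : (2 : ℝ) • ((1 + X) * (q * q)) = (1 + X) * q * ((1 + X) * q) + (1 - X ^ 2) * (q * q) := by
    rw [two_smul]; ring
  have e2 := congrArg L e
  rw [map_smul, map_add, smul_eq_mul] at e2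
  linarith

theorem GoodF.lin {L : ℝ[X] →ₗ[ℝ] ℝ} (h : GoodF L) (f : ℝ[X]) (hd : f.degree ≤ 1)
    (h1 : 0 < f.eval 1) (h2 : 0 < f.eval (-1)) (q : ℝ[X]) : 0 ≤ L (f * (q * q)) := by
  rw [eq_X_add_C_of_degree_le_one hd] at h1 h2 ⊢
  generalize f.coeff 1 = a at *
  generalize f.coeff 0 = b at *
  simp at h1 h2
  have e : (C a * X + C b) * (q * q) = ((b + a) / 2) • ((1 + X) * (q * q))
      + ((b - a) / 2) • ((1 - X) * (q * q)) := by
    rw [smul_eq_C_mul, smul_eq_C_mul]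
    have ha : (b + a) / 2 - (b - a) / 2 = a := by ring
    have hb : (b + a) / 2 + (b - a) / 2 = b := by ring
    have hA : C a = C ((b + a) / 2) - C ((b - a) / 2) := by rw [← C_sub, ha]
    have hB : C b = C ((b + a) / 2) + C ((b - a) / 2) := by rw [← C_add, hb]
    rw [hA, hB]; ring
  rw [e, map_add, map_smul, map_smul, smul_eq_mul, smul_eq_mul]
  have := h.one_add q
  have := h.one_sub q
  have : 0 ≤ (b + a) / 2 := by linarith
  have : 0 ≤ (b - a) / 2 := by linarith
  positivity

theorem GoodF.quad {L : ℝ[X] →ₗ[ℝ] ℝ} (h : GoodF L) (f : ℝ[X]) (hd : f.degree = 2)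
    (hp : ∀ x, 0 < f.eval x) (q : ℝ[X]) : 0 ≤ L (f * (q * q)) := by
  have ha0 : f.coeff 2 ≠ 0 := coeff_ne_zero_of_eq_degree hd
  rw [eq_quadratic_of_degree_le_two hd.le] at hp ⊢
  generalize f.coeff 2 = a at *
  generalize f.coeff 1 = b at *
  generalize f.coeff 0 = c at *
  simp at hp
  have hc : 0 < c := by simpa using hp 0
  have hdisc := discrim_le_zero (a := a) (b := b) (c := c) (fun x => by have := hp x; nlinarith)
  rw [discrim] at hdisc
  have ha : 0 < a := by
    rcases lt_or_gt_of_ne ha0 with h | h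
    · nlinarith [sq_nonneg b, mul_neg_of_neg_of_pos h hc]
    · exact h
  have hm := hp (-b / (2 * a))
  set d := a * (-b / (2 * a)) ^ 2 + b * (-b / (2 * a)) + c with hdd
  set r := b / (2 * a) with hr
  have hb : b = 2 * (a * r) := by rw [hr]; field_simp
  have hcd : c = a * r ^ 2 + d := by
    rw [hdd, hr]; field_simp; ring
  have e : (C a * X ^ 2 + C b * X + C c) * (q * q) = a • (((X + C r) * q) * ((X + C r) * q))
      + d • (q * q) := by
    rw [smul_eq_C_mul, smul_eq_C_mul, hb, hcd]
    simp only [C_add, C_mul, C_pow]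
    have : (C (2 : ℝ)) = 2 := rfl
    rw [this]; ring
  rw [e, map_add, map_smul, map_smul, smul_eq_mul, smul_eq_mul]
  have := h.1 q
  have := h.1 ((X + C r) * q)
  positivity

theorem sign_const {S : Set ℝ} (hS : S.OrdConnected) (f : ℝ[X]) {x0 : ℝ} (hx0 : x0 ∈ S)
    (h0 : 0 < f.eval x0) (hne : ∀ x ∈ S, f.eval x ≠ 0) : ∀ x ∈ S, 0 < f.eval x := by
  intro x hx
  by_contra hneg
  push Not at hneg
  have hpre := hS.isPreconnected
  obtain ⟨y, hy, hy'⟩ := hpre.intermediate_value hx hx0 (f := fun x => f.eval x)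
    f.continuous.continuousOn ⟨hneg, h0.le⟩
  exact hne y hy hy'

theorem pos_of_pos (n : ℕ) : ∀ (p : ℝ[X]), p.natDegree ≤ n →
    (∀ x ∈ Set.Icc (-1 : ℝ) 1, 0 < p.eval x) →
    ∀ L : ℝ[X] →ₗ[ℝ] ℝ, GoodF L → 0 ≤ L p := by
  induction n with
  | zero =>
    intro p hd hp L hL
    rw [eq_C_of_natDegree_le_zero hd] at hp ⊢
    have h0 := hp 0 (by simp)
    rw [eval_C] at h0
    have e : C (p.coeff 0) = (p.coeff 0) • (1 * 1 : ℝ[X]) := by rw [smul_eq_C_mul]; simp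
    rw [e, map_smul, smul_eq_mul]
    exact mul_nonneg h0.le (hL.1 1)
  | succ n ih =>
    intro p hd hp L hL
    by_cases hdn : p.natDegree ≤ n
    · exact ih p hdn hp L hL
    have hp0 : p ≠ 0 := by rintro rfl; simp at hdn
    have hnu : ¬ IsUnit p := fun hu => by
      have := natDegree_eq_zero_of_isUnit hu; omega
    obtain ⟨q, hq, r, hqr⟩ := WfDvdMonoid.exists_irreducible_factor hnu hp0
    -- choose sign
    obtain ⟨q, r, hq, hqr, hq1⟩ : ∃ q r : ℝ[X], Irreducible q ∧ p = q * r ∧ 0 < q.eval 0 := by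
      have h0 := hp 0 (by simp)
      rw [hqr, eval_mul] at h0
      rcases lt_trichotomy (q.eval 0) 0 with h | h | h
      · refine ⟨-q, -r, ?_, by rw [hqr]; ring, by simpa using h⟩
        exact (Associated.neg_left (Associated.refl q)).irreducible_iff.mpr hq
      · rw [h] at h0; simp at h0
      · exact ⟨q, r, hq, hqr, h⟩
    have hne : ∀ x ∈ Set.Icc (-1 : ℝ) 1, q.eval x ≠ 0 := by
      intro x hx h
      have := hp x hx
      rw [hqr, eval_mul, h] at this; simp at this
    have hqp := sign_const Set.ordConnected_Icc q (by simp) hq1 hne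
    have hrp : ∀ x ∈ Set.Icc (-1 : ℝ) 1, 0 < r.eval x := by
      intro x hx
      have := hp x hx
      rw [hqr, eval_mul] at this
      exact (pos_iff_pos_of_mul_pos this).mp (hqp x hx)
    have hdq : 0 < q.natDegree := hq.natDegree_pos
    have hr0 : r ≠ 0 := by rintro rfl; simp at hqr; exact hp0 hqr
    have hdr : r.natDegree ≤ n := by
      have := natDegree_mul hq.ne_zero hr0
      rw [← hqr] at this; omega
    have hgood : GoodF (L.comp (LinearMap.mulLeft ℝ q)) := by
      apply hL.mul
      by_cases hd1 : q.degree ≤ 1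
      · exact hL.lin q hd1 (hqp 1 (by simp)) (hqp (-1) (by simp))
      · have hd2 : q.degree = 2 := by
          have h2 := hq.degree_le_two
          rw [degree_eq_natDegree hq.ne_zero] at h2 hd1 ⊢
          norm_cast at h2 hd1 ⊢
          omega
        apply hL.quad q hd2
        have : ∀ x ∈ (Set.univ : Set ℝ), q.eval x ≠ 0 := by
          intro x _ hx
          have := degree_eq_one_of_irreducible_of_root hq hx
          rw [hd2] at this; norm_num at this
        exact fun x => sign_const Set.ordConnected_univ q (Set.mem_univ 0) hq1 this x trivial
    have := ih r hdr hrp _ hgood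
    rw [hqr]; simpa using this

theorem nonneg_of_nonneg {L : ℝ[X] →ₗ[ℝ] ℝ} (hL : GoodF L) (p : ℝ[X])
    (hp : ∀ x ∈ Set.Icc (-1 : ℝ) 1, 0 ≤ p.eval x) : 0 ≤ L p := by
  have h : ∀ ε : ℝ, 0 < ε → 0 ≤ L p + ε * L 1 := by
    intro ε hε
    have := pos_of_pos _ (p + ε • 1) le_rfl (fun x hx => by
      have := hp x hx
      simp; linarith) L hL
    simpa using this
  have h1 : 0 ≤ L 1 := by simpa using hL.1 1
  by_contra hneg
  push Not at hneg
  have := h (-L p / (2 * (L 1 + 1))) (by apply div_pos <;> linarith)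
  have e : -L p / (2 * (L 1 + 1)) * L 1 ≤ - L p / 2 := by
    rw [div_mul_eq_mul_div, div_le_div_iff₀ (by linarith) (by norm_num)]
    nlinarith
  linarith

theorem exists_measure {L : ℝ[X] →ₗ[ℝ] ℝ} (hL : GoodF L) (h1 : L 1 = 1) :
    ∃ μ : Measure (Set.Icc (-1 : ℝ) 1), IsProbabilityMeasure μ ∧
      ∀ n : ℕ, L (X ^ n) = ∫ s : Set.Icc (-1 : ℝ) 1, (s : ℝ) ^ n ∂μ := by
  let I := Set.Icc (-1 : ℝ) 1
  let J : ℝ[X] →ₗ[ℝ] C(I, ℝ) := (toContinuousMapOnAlgHom I).toLinearMap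
  have hJ : ∀ p (x : I), J p x = p.eval (x : ℝ) := fun p x => rfl
  have hinj : Function.Injective J := by
    intro p q h
    refine Polynomial.eq_of_infinite_eval_eq p q ?_
    refine (Set.Icc_infinite (show (-1 : ℝ) < 1 by norm_num)).mono fun x hx => ?_
    exact DFunLike.congr_fun h (⟨x, hx⟩ : I)
  let f : C(I, ℝ) →ₗ.[ℝ] ℝ := ⟨LinearMap.range J, L ∘ₗ (LinearEquiv.ofInjective J hinj).symm.toLinearMap⟩
  have hfJ : ∀ p, f ⟨J p, LinearMap.mem_range_self J p⟩ = L p := by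
    intro p
    show L ((LinearEquiv.ofInjective J hinj).symm _) = L p
    congr 1
    rw [LinearEquiv.symm_apply_eq]; rfl
  let P : PointedCone ℝ C(I, ℝ) :=
    { carrier := {g | ∀ x, 0 ≤ g x}
      add_mem' := fun {a b} ha hb x => add_nonneg (ha x) (hb x)
      zero_mem' := fun x => le_rfl
      smul_mem' := fun c g hg x => mul_nonneg c.2 (hg x) }
  have hP : ∀ g, g ∈ P ↔ ∀ x, 0 ≤ g x := fun g => Iff.rfl
  obtain ⟨g, hg1, hg2⟩ := riesz_extension P f (by
    rintro ⟨_, p, rfl⟩ hx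
    rw [hfJ]
    exact nonneg_of_nonneg hL p fun x hx' => hx ⟨x, hx'⟩) (by
    intro y
    refine ⟨⟨J (C ‖y‖), LinearMap.mem_range_self J _⟩, ?_⟩
    rw [hP]
    intro x
    have := (abs_le.mp (y.norm_coe_le_norm x)).1
    simp [hJ]; linarith)
  have hg : ∀ p, g (J p) = L p := fun p => by
    rw [← hfJ p]; exact hg1 ⟨J p, LinearMap.mem_range_self J p⟩
  let Λ0 : CompactlySupportedContinuousMap I ℝ →ₗ[ℝ] ℝ :=
    { toFun := fun u => g u.toContinuousMap
      map_add' := fun u v => by rw [← map_add]; rfl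
      map_smul' := fun c u => by rw [RingHom.id_apply, ← map_smul]; rfl }
  let Λ := PositiveLinearMap.mk₀ Λ0 (fun u hu => hg2 u.toContinuousMap (fun x => CompactlySupportedContinuousMap.le_def.mp hu x))
  have hint : ∀ p : ℝ[X], ∫ s : I, p.eval (s : ℝ) ∂(RealRMK.rieszMeasure Λ) = L p := by
    intro p
    have := RealRMK.integral_rieszMeasure Λ
      (CompactlySupportedContinuousMap.continuousMapEquiv (J p))
    rw [← hg p]; exact this
  refine ⟨RealRMK.rieszMeasure Λ, ⟨?_⟩, fun n => ?_⟩
  · have := hint 1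
    rw [h1] at this
    simp at this
    rwa [measureReal_def, ENNReal.toReal_eq_one_iff] at this
  · rw [← hint]; simp; rfl

theorem measure_unique (μ ν : Measure (Set.Icc (-1 : ℝ) 1)) [IsProbabilityMeasure μ]
    [IsProbabilityMeasure ν]
    (h : ∀ n : ℕ, ∫ s : Set.Icc (-1 : ℝ) 1, (s : ℝ) ^ n ∂μ = ∫ s : Set.Icc (-1 : ℝ) 1, (s : ℝ) ^ n ∂ν) :
    μ = ν := by
  have hi : ∀ (m : Measure (Set.Icc (-1 : ℝ) 1)) [IsProbabilityMeasure m]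
      (f : Set.Icc (-1 : ℝ) 1 → ℝ) (_ : Continuous f), Integrable f m := fun m _ f hf =>
    hf.integrable_of_hasCompactSupport (HasCompactSupport.of_compactSpace _)
  have hpoly : ∀ p : ℝ[X], ∫ s : Set.Icc (-1 : ℝ) 1, p.eval (s : ℝ) ∂μ
      = ∫ s : Set.Icc (-1 : ℝ) 1, p.eval (s : ℝ) ∂ν := by
    intro p
    simp only [eval_eq_sum_range]
    rw [integral_finsetSum _ fun n _ => hi μ _ (by fun_prop),
      integral_finsetSum _ fun n _ => hi ν _ (by fun_prop)]
    refine Finset.sum_congr rfl fun n _ => ?_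
    rw [integral_const_mul, integral_const_mul, h]
  apply ext_of_forall_integral_eq_of_IsFiniteMeasure
  intro f
  have hclose : ∀ ε : ℝ, 0 < ε → |∫ x, f x ∂μ - ∫ x, f x ∂ν| ≤ 2 * ε := by
    intro ε hε
    obtain ⟨p, hp⟩ := exists_polynomial_near_continuousMap (-1) 1 f.toContinuousMap ε hε
    have hb : ∀ (m : Measure (Set.Icc (-1 : ℝ) 1)) [IsProbabilityMeasure m],
        |∫ x, f x ∂m - ∫ s : Set.Icc (-1 : ℝ) 1, p.eval (s : ℝ) ∂m| ≤ ε := by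
      intro m _
      rw [← integral_sub (hi m _ f.continuous) (hi m _ (by fun_prop))]
      have := norm_integral_le_of_norm_le_const (μ := m) (C := ε)
        (f := fun x : Set.Icc (-1 : ℝ) 1 => f x - p.eval (x : ℝ)) (Filter.Eventually.of_forall ?_)
      · simpa using this
      · intro x
        have := (ContinuousMap.norm_coe_le_norm _ x).trans hp.le
        rw [← norm_neg]
        simpa using this
    have h1 := hb μ
    have h2 := hb ν
    rw [hpoly p] at h1
    rw [abs_le] at *
    constructor <;> linarith
  by_contra hne
  have hpos := abs_pos.mpr (sub_ne_zero.mpr hne)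
  have := hclose (|∫ x, f x ∂μ - ∫ x, f x ∂ν| / 4) (by linarith)
  linarith

theorem goodF_of_hankel (m : ℕ → ℝ) (hb : ∀ n, |m n| ≤ 1)
    (hH : ∀ (n : ℕ) (c : Fin n → ℝ), 0 ≤ ∑ j, ∑ k, c j * c k * m (j + k)) :
    ∃ L : ℝ[X] →ₗ[ℝ] ℝ, GoodF L ∧ ∀ n, L (X ^ n) = m n := by
  let L : ℝ[X] →ₗ[ℝ] ℝ := Polynomial.lsum fun n => (LinearMap.id (R := ℝ) (M := ℝ)).smulRight (m n)
  have hLX : ∀ n, L (X ^ n) = m n := by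
    intro n
    simp [L, Polynomial.lsum_apply, ← monomial_one_right_eq_X_pow]
  have hexp : ∀ q : ℝ[X], q = ∑ i : Fin (q.natDegree + 1), q.coeff i • X ^ (i : ℕ) := by
    intro q
    conv_lhs => rw [q.as_sum_range_C_mul_X_pow, Finset.sum_range]
    simp only [smul_eq_C_mul]
  refine ⟨L, ⟨fun q => ?_, fun q => ?_⟩, hLX⟩
  · have e : L (q * q) = ∑ j : Fin (q.natDegree + 1), ∑ k : Fin (q.natDegree + 1),
        q.coeff j * q.coeff k * m (j + k) := by
      conv_lhs => rw [hexp q]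
      rw [Finset.sum_mul_sum, map_sum]
      refine Finset.sum_congr rfl fun j _ => ?_
      rw [map_sum]
      refine Finset.sum_congr rfl fun k _ => ?_
      rw [smul_mul_smul_comm, ← pow_add, map_smul, hLX, smul_eq_mul]
    rw [e]; exact hH _ _
  · refine ⟨∑ i : Fin (q.natDegree + 1), |q.coeff i|, fun n => ?_⟩
    conv_lhs => rw [hexp q]
    rw [Finset.mul_sum, map_sum]
    refine (Finset.abs_sum_le_sum_abs _ _).trans (Finset.sum_le_sum fun i _ => ?_)
    rw [mul_smul_comm, ← pow_add, map_smul, hLX, smul_eq_mul, abs_mul]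
    exact mul_le_of_le_one_right (abs_nonneg _) (hb _)
end Moment

/-- Haagerup–Knudby type characterization: a radial function (w.r.t. the squared ℓ² length)
on the free group on countably infinitely many generators with `φ(e) = 1` is positive
definite iff it is the moment transform `φ(g) = ∫_{-1}^1 s^{‖g‖₂²} dμ(s)` of a probability
measure `μ` on `[-1,1]`; moreover such a `μ` is unique. -/
theorem posDef_iff_moment_l2sq
    (φ : FreeGroup ℕ → ℝ)
    (hrad : ∃ φdot : ℕ → ℝ, ∀ g : FreeGroup ℕ, φ g = φdot (l2sq g))
    (hone : φ 1 = 1) :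
    (IsPositiveDefinite φ ↔
      ∃ μ : Measure (Set.Icc (-1 : ℝ) 1), IsProbabilityMeasure μ ∧
        ∀ g : FreeGroup ℕ, φ g = ∫ s : Set.Icc (-1 : ℝ) 1, (s : ℝ) ^ l2sq g ∂μ) ∧
    ∀ μ ν : Measure (Set.Icc (-1 : ℝ) 1),
      IsProbabilityMeasure μ → IsProbabilityMeasure ν →
      (∀ g : FreeGroup ℕ, φ g = ∫ s : Set.Icc (-1 : ℝ) 1, (s : ℝ) ^ l2sq g ∂μ) →
      (∀ g : FreeGroup ℕ, φ g = ∫ s : Set.Icc (-1 : ℝ) 1, (s : ℝ) ^ l2sq g ∂ν) →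
      μ = ν := by
  obtain ⟨m, hm⟩ := hrad
  refine ⟨⟨fun h => ?_, ?_⟩, ?_⟩
  · have hb : ∀ n, |m n| ≤ 1 := by
      intro n
      obtain ⟨g, rfl⟩ := exists_l2sq n
      rw [← hm]
      exact abs_le_one h (fun g => by rw [hm, hm, l2sq_inv]) hone g
    obtain ⟨L, hL, hLX⟩ := goodF_of_hankel m hb (hankel h m hm hone)
    have h1 : L 1 = 1 := by
      have := hLX 0
      rw [pow_zero] at this
      rw [this, ← hone, hm, l2sq_one]
    obtain ⟨μ, hμ, hμ'⟩ := exists_measure hL h1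
    exact ⟨μ, hμ, fun g => by rw [hm, ← hLX, hμ']⟩
  · rintro ⟨μ, hμ, h⟩
    exact posdef_of_moment μ h
  · intro μ ν hμ hν h1 h2
    refine measure_unique μ ν fun n => ?_
    obtain ⟨g, rfl⟩ := exists_l2sq n
    rw [← h1, ← h2]
end

section
/- Let μ be a Borel probability measure on [−1, 1]. Then the function φ : F_∞ → ℝ defined by φ(g) = ∫_{−1}^{1} s^{‖g‖₂²} dμ(s) is positive definite on the free group F_∞ on countably infinitely many generators. -/
open ComplexOrder

open MeasureTheory

namespace L2Moment

/-- rank one kernels are positive semidefinite -/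
lemma psd_rank_one {X : Type*} (f : X → ℝ) :
    (Matrix.of fun i j => f i * f j : Matrix X X ℝ).PosSemidef := by
  refine ⟨?_, fun x => ?_⟩
  · ext i j
    simp [Matrix.conjTranspose_apply, mul_comm]
  · have : (x.sum fun i xi ↦ x.sum fun j xj ↦
        star xi * (Matrix.of fun i j => f i * f j : Matrix X X ℝ) i j * xj)
        = (x.sum fun i xi => xi * f i) ^ 2 := by
      simp only [Finsupp.sum, sq, Finset.sum_mul_sum, Matrix.of_apply, star_trivial]
      refine Finset.sum_congr rfl fun i _ => Finset.sum_congr rfl fun j _ => ?_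
      ring
    rw [this]
    positivity

lemma psd_limit {X : Type*} (A : ℕ → Matrix X X ℝ) (B : Matrix X X ℝ)
    (hA : ∀ n, (A n).PosSemidef)
    (h : ∀ i j, Filter.Tendsto (fun n => A n i j) Filter.atTop (nhds (B i j))) :
    B.PosSemidef := by
  refine ⟨?_, fun x => ?_⟩
  · ext i j
    refine tendsto_nhds_unique ?_ (h i j)
    have := h j i
    refine this.congr fun n => ?_
    have := (hA n).1.apply i j
    simpa using this
  · refine ge_of_tendsto' (f := fun n => x.sum fun i xi ↦ x.sum fun j xj ↦
        star xi * A n i j * xj) (x := Filter.atTop) ?_ (fun n => (hA n).2 x)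
    simp only [Finsupp.sum]
    refine tendsto_finsetSum _ fun i _ => tendsto_finsetSum _ fun j _ => ?_
    exact ((h i j).const_mul _).mul_const _

/-- the kernel of the one-generator function, after removing the constants -/
def vker (s : ℝ) : Matrix ℤ ℤ ℝ :=
  Matrix.of fun k l => s ^ ((l - k).natAbs ^ 2) - s ^ (k.natAbs ^ 2) * s ^ (l.natAbs ^ 2)

lemma psd_exp (c : ℝ) (hc : 0 ≤ c) :
    (Matrix.of fun k l : ℤ => Real.exp (c * k * l) - 1 : Matrix ℤ ℤ ℝ).PosSemidef := by
  refine psd_limit (fun N => ∑ n ∈ Finset.range N, (c ^ (n + 1) / ((n + 1).factorial : ℝ)) •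
    (Matrix.of fun k l : ℤ => ((k : ℝ) ^ (n + 1)) * (l : ℝ) ^ (n + 1) : Matrix ℤ ℤ ℝ)) _ ?_ ?_
  · intro N
    refine Matrix.posSemidef_sum _ fun n _ => ?_
    exact (psd_rank_one (fun k : ℤ => (k : ℝ) ^ (n + 1))).smul (by positivity)
  · intro k l
    have h1 : HasSum (fun n : ℕ => (c * k * l) ^ n / (n.factorial : ℝ)) (Real.exp (c * k * l)) := by
      rw [Real.exp_eq_exp_ℝ]
      exact NormedSpace.expSeries_div_hasSum_exp (c * k * l : ℝ)
    have h2 := ((hasSum_nat_add_iff' 1).2 h1).tendsto_sum_nat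
    simp only [Finset.range_one, Finset.sum_singleton, pow_zero, Nat.factorial_zero, Nat.cast_one,
      div_one] at h2
    refine h2.congr fun N => ?_
    simp only [Matrix.sum_apply, Matrix.smul_apply, Matrix.of_apply, smul_eq_mul]
    refine Finset.sum_congr rfl fun n _ => ?_
    rw [mul_pow, mul_pow]
    ring

lemma psd_vker (s : ℝ) (hs : |s| ≤ 1) : (vker s).PosSemidef := by
  by_cases h0 : s = 0
  · have h1 : vker s = (1 : Matrix ℤ ℤ ℝ).hadamard
        (Matrix.of fun k l : ℤ => (if k = 0 then (0:ℝ) else 1) * (if l = 0 then 0 else 1)) := by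
      ext k l
      subst h0
      simp only [vker, Matrix.of_apply, Matrix.hadamard_apply, Matrix.one_apply]
      by_cases hkl : k = l
      · subst hkl
        by_cases hk : k = 0 <;> simp [hk]
      · have : l - k ≠ 0 := by omega
        by_cases hk : k = 0 <;> by_cases hl : l = 0 <;> simp_all
    rw [h1]
    exact Matrix.PosSemidef.one.hadamard (psd_rank_one _)
  · have hs2 : 0 < s ^ 2 := by positivity
    have hc : 0 ≤ - Real.log (s ^ 2) := by
      have : s ^ 2 ≤ 1 := by rw [sq_le_one_iff_abs_le_one]; exact hs
      have := Real.log_nonpos hs2.le this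
      linarith
    have h1 : vker s = (Matrix.of fun k l : ℤ => s ^ (k.natAbs ^ 2) * s ^ (l.natAbs ^ 2)).hadamard
        (Matrix.of fun k l : ℤ => Real.exp (- Real.log (s ^ 2) * k * l) - 1) := by
      ext k l
      simp only [vker, Matrix.of_apply, Matrix.hadamard_apply]
      have e : ∀ m : ℤ, s ^ (m.natAbs ^ 2) = s ^ (m ^ 2) := by
        intro m
        rw [← zpow_natCast]
        congr 1
        push_cast
        simp
      have e2 : Real.exp (- Real.log (s ^ 2) * k * l) = s ^ (-2 * k * l) := by
        have : - Real.log (s ^ 2) * k * l = Real.log (s ^ 2) * ((-(k * l) : ℤ) : ℝ) := by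
          push_cast; ring
        rw [this, ← Real.rpow_def_of_pos hs2, Real.rpow_intCast, ← zpow_natCast, ← zpow_mul]
        congr 1
        push_cast; ring
      rw [e, e, e, e2, mul_sub, ← zpow_add₀ h0, ← zpow_add₀ h0, mul_one]
      congr 2
      ring
    rw [h1]
    exact (psd_rank_one _).hadamard (psd_exp _ hc)

/-- sum of squares of exponents in a block list -/
def nn (L : List (ℕ × ℤ)) : ℕ := (L.map fun p => p.2.natAbs ^ 2).sum

/-- remainder kernel on block lists (with fuel) -/
noncomputable def rker (s : ℝ) : ℕ → Matrix (List (ℕ × ℤ)) (List (ℕ × ℤ)) ℝ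
  | 0 => 0
  | n + 1 => ((Matrix.of fun L M => (if L = [] then (0:ℝ) else 1) * (if M = [] then 0 else 1)).hadamard
      ((1 : Matrix ℕ ℕ ℝ).submatrix (fun L => (L.headD (0, 0)).1) (fun L => (L.headD (0, 0)).1))).hadamard
      (((vker s).submatrix (fun L => (L.headD (0, 0)).2) (fun L => (L.headD (0, 0)).2)).hadamard
        (Matrix.of fun L M => s ^ nn L.tail * s ^ nn M.tail) +
      ((1 : Matrix ℤ ℤ ℝ).submatrix (fun L => (L.headD (0, 0)).2) (fun L => (L.headD (0, 0)).2)).hadamard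
        ((rker s n).submatrix List.tail List.tail))

lemma psd_rker (s : ℝ) (hs : |s| ≤ 1) (n : ℕ) : (rker s n).PosSemidef := by
  induction n with
  | zero => exact Matrix.PosSemidef.zero
  | succ n ih =>
    refine ((psd_rank_one _).hadamard (Matrix.PosSemidef.one.submatrix _)).hadamard ?_
    refine Matrix.PosSemidef.add ?_ ?_
    · exact ((psd_vker s hs).submatrix _).hadamard (psd_rank_one fun L : List (ℕ × ℤ) => s ^ nn L.tail)
    · exact (Matrix.PosSemidef.one.submatrix _).hadamard (ih.submatrix _)

lemma rker_nil_left (s : ℝ) (n : ℕ) (M) : rker s n [] M = 0 := by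
  cases n <;> simp [rker]

lemma rker_nil_right (s : ℝ) (n : ℕ) (M) : rker s n M [] = 0 := by
  cases n <;> simp [rker]

lemma rker_cons (s : ℝ) (n : ℕ) (a b : ℕ) (k l : ℤ) (L M) :
    rker s (n + 1) ((a, k) :: L) ((b, l) :: M) = if a = b then
      vker s k l * (s ^ nn L * s ^ nn M) + (if k = l then rker s n L M else 0) else 0 := by
  by_cases hab : a = b <;> by_cases hkl : k = l <;> simp [rker, Matrix.one_apply, hab, hkl]

/-- reduced block lists -/
def Valid (L : List (ℕ × ℤ)) : Prop :=
  L.IsChain (fun p q => p.1 ≠ q.1) ∧ ∀ p ∈ L, p.2 ≠ 0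

/-- evaluation of a block list -/
def ev (L : List (ℕ × ℤ)) : FreeGroup ℕ := (L.map fun p => FreeGroup.of p.1 ^ p.2).prod

/-- inverse block list -/
def rv (L : List (ℕ × ℤ)) : List (ℕ × ℤ) := (L.map fun p => (p.1, -p.2)).reverse

/-- letters of a block list -/
def flat (L : List (ℕ × ℤ)) : List (ℕ × Bool) :=
  L.flatMap fun p => List.replicate p.2.natAbs (p.1, decide (0 < p.2))

lemma ev_rv (L) : ev (rv L) = (ev L)⁻¹ := by
  simp [ev, rv, List.prod_inv_reverse, List.map_reverse, Function.comp_def]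

lemma nn_rv (L) : nn (rv L) = nn L := by
  simp [nn, rv, List.map_reverse, List.sum_reverse, Function.comp_def]

lemma nn_append (L M) : nn (L ++ M) = nn L + nn M := by simp [nn]

lemma ev_append (L M) : ev (L ++ M) = ev L * ev M := by simp [ev]

lemma valid_rv {L} (h : Valid L) : Valid (rv L) := by
  refine ⟨?_, ?_⟩
  · rw [rv, List.isChain_reverse, List.isChain_map]
    exact h.1.imp fun p q hpq => Ne.symm hpq
  · intro p hp
    simp only [rv, List.mem_reverse, List.mem_map] at hp
    obtain ⟨q, hq, rfl⟩ := hp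
    simpa using h.2 q hq

lemma mk_pow (a : ℕ) (b : Bool) (n : ℕ) :
    FreeGroup.mk (List.replicate n (a, b)) = FreeGroup.mk [(a, b)] ^ n := by
  induction n with
  | zero => rfl
  | succ n ih => rw [pow_succ', ← ih, FreeGroup.mul_mk]; rfl

lemma mk_flat (L) : FreeGroup.mk (flat L) = ev L := by
  induction L with
  | nil => rfl
  | cons p L ih =>
    obtain ⟨a, k⟩ := p
    have h1 : flat ((a, k) :: L) = List.replicate k.natAbs (a, decide (0 < k)) ++ flat L := by
      simp [flat]
    have h2 : ev ((a, k) :: L) = FreeGroup.of a ^ k * ev L := by simp [ev]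
    rw [h1, h2, ← FreeGroup.mul_mk, ih, mk_pow]
    congr 1
    rcases lt_or_ge 0 k with hk | hk
    · obtain ⟨m, rfl⟩ := Int.eq_ofNat_of_zero_le hk.le
      rw [decide_eq_true hk]
      simp [FreeGroup.of]
    · obtain ⟨m, hm⟩ := Int.eq_ofNat_of_zero_le (a := -k) (by omega)
      obtain rfl : k = -m := by omega
      have : FreeGroup.mk [(a, false)] = (FreeGroup.of a)⁻¹ := by
        simp [FreeGroup.of, FreeGroup.inv_mk, FreeGroup.invRev]
      rw [decide_eq_false (by omega), this]
      simp

lemma valid_tail {p L} (h : Valid (p :: L)) : Valid L :=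
  ⟨h.1.tail, fun q hq => h.2 q (List.mem_cons_of_mem _ hq)⟩

lemma flat_head {L} (h : Valid L) (x) (hx : x ∈ (flat L).head?) : ∃ p ∈ L.head?, p.1 = x.1 := by
  cases L with
  | nil => simp [flat] at hx
  | cons p L =>
    refine ⟨p, by simp, ?_⟩
    have hp := h.2 p (by simp)
    obtain ⟨m, hm⟩ := Nat.exists_eq_succ_of_ne_zero (Int.natAbs_ne_zero.2 hp)
    simp [flat, hm, List.replicate_succ] at hx
    rw [← hx]

lemma flat_reduced {L} (h : Valid L) : FreeGroup.IsReduced (flat L) := by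
  induction L with
  | nil => simp [flat]
  | cons p L ih =>
    have h1 : flat (p :: L) = List.replicate p.2.natAbs (p.1, decide (0 < p.2)) ++ flat L := by
      simp [flat]
    rw [h1]
    refine List.IsChain.append (List.isChain_replicate_of_rel _ (by simp)) (ih (valid_tail h)) ?_
    intro x hx y hy hxy
    exfalso
    obtain ⟨q, hq, hqy⟩ := flat_head (valid_tail h) y hy
    have hx' := List.eq_of_mem_replicate (List.mem_of_mem_getLast? hx)
    have := (List.isChain_cons.1 h.1).1 q hq
    apply this
    rw [hqy, ← hxy, hx']

lemma aux_replicate (a : ℕ) (b : Bool) (n m : ℕ) (l) :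
    blockSqSumAux a n (List.replicate m (a, b) ++ l) = blockSqSumAux a (n + m) l := by
  induction m generalizing n with
  | zero => simp
  | succ m ih =>
    rw [List.replicate_succ, List.cons_append, blockSqSumAux, if_pos rfl, ih]
    congr 1; omega

lemma flat_cons {a : ℕ} {k : ℤ} {L} (hk : k ≠ 0) : flat ((a, k) :: L) =
    (a, decide (0 < k)) :: (List.replicate (k.natAbs - 1) (a, decide (0 < k)) ++ flat L) := by
  obtain ⟨m, hm⟩ := Nat.exists_eq_succ_of_ne_zero (Int.natAbs_ne_zero.2 hk)
  simp [flat, hm, List.replicate_succ]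

lemma aux_flat (a : ℕ) (n : ℕ) {L} (h : Valid L) (hL : ∀ p ∈ L.head?, p.1 ≠ a) :
    blockSqSumAux a n (flat L) = n ^ 2 + nn L := by
  induction L generalizing a n with
  | nil => simp [flat, blockSqSumAux, nn]
  | cons p L ih =>
    obtain ⟨b, k⟩ := p
    have hk : k ≠ 0 := h.2 (b, k) (by simp)
    have hk' := Int.natAbs_ne_zero.2 hk
    have hb : b ≠ a := hL (b, k) (by simp)
    rw [flat_cons hk, blockSqSumAux, if_neg hb, aux_replicate, ih _ _ (valid_tail h)]
    · have : 1 + (k.natAbs - 1) = k.natAbs := by omega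
      rw [this]; simp [nn]
    · intro q hq
      exact ((List.isChain_cons.1 h.1).1 q hq).symm

lemma l2sq_ev {L} (h : Valid L) : l2sq (ev L) = nn L := by
  have hw : (ev L).toWord = flat L := by
    rw [← mk_flat, FreeGroup.toWord_mk, (flat_reduced h).reduce_eq]
  rw [l2sq, hw]
  cases L with
  | nil => simp [flat, nn]
  | cons p L =>
    obtain ⟨b, k⟩ := p
    have hk : k ≠ 0 := h.2 (b, k) (by simp)
    have hk' := Int.natAbs_ne_zero.2 hk
    rw [flat_cons hk]
    simp only
    rw [aux_replicate, aux_flat _ _ (valid_tail h)]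
    · have : 1 + (k.natAbs - 1) = k.natAbs := by omega
      rw [this]; simp [nn]
    · intro q hq
      exact ((List.isChain_cons.1 h.1).1 q hq).symm

lemma valid_cons {a : ℕ} {k : ℤ} {L} (hk : k ≠ 0) (h : Valid L) (hL : ∀ p ∈ L.head?, a ≠ p.1) :
    Valid ((a, k) :: L) := by
  refine ⟨List.isChain_cons.2 ⟨hL, h.1⟩, ?_⟩
  intro p hp
  rcases List.mem_cons.1 hp with rfl | hp
  · exact hk
  · exact h.2 p hp

lemma valid_head {a : ℕ} {k : ℤ} {L} (h : Valid ((a, k) :: L)) : ∀ p ∈ L.head?, a ≠ p.1 :=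
  (List.isChain_cons.1 h.1).1

lemma exists_mul_letter (a : ℕ) (e : ℤ) (he : e ≠ 0) {L} (h : Valid L) :
    ∃ M, Valid M ∧ ev M = FreeGroup.of a ^ e * ev L := by
  have key : ∀ {L}, Valid L → (∀ p ∈ L.head?, a ≠ p.1) →
      ∃ M, Valid M ∧ ev M = FreeGroup.of a ^ e * ev L := fun {L} h hL =>
    ⟨(a, e) :: L, valid_cons he h hL, by simp [ev]⟩
  cases L with
  | nil => exact key h (by simp)
  | cons p L =>
    obtain ⟨b, k⟩ := p
    by_cases hb : a = b
    · subst hb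
      have he : FreeGroup.of a ^ e * ev ((a, k) :: L) = FreeGroup.of a ^ (e + k) * ev L := by
        simp [ev, zpow_add, mul_assoc]
      rw [he]
      by_cases hk : e + k = 0
      · exact ⟨L, valid_tail h, by simp [hk]⟩
      · exact ⟨(a, e + k) :: L, valid_cons hk (valid_tail h) (valid_head h), by simp [ev]⟩
    · exact key h (by simpa using hb)

lemma exists_ev (g : FreeGroup ℕ) : ∃ L, Valid L ∧ ev L = g := by
  have : ∀ w : List (ℕ × Bool), ∃ L, Valid L ∧ ev L = FreeGroup.mk w := by
    intro w
    induction w with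
    | nil => exact ⟨[], ⟨by simp, by simp⟩, rfl⟩
    | cons p w ih =>
      obtain ⟨L, hL, e⟩ := ih
      obtain ⟨a, b⟩ := p
      have hw : FreeGroup.mk ((a, b) :: w) = FreeGroup.mk [(a, b)] * FreeGroup.mk w := by
        rw [FreeGroup.mul_mk]; rfl
      rw [hw, ← e]
      cases b with
      | true => simpa [FreeGroup.of] using exists_mul_letter a 1 (by simp) hL
      | false =>
        have : FreeGroup.mk [(a, false)] = (FreeGroup.of a) ^ (-1 : ℤ) := by
          simp [FreeGroup.of, FreeGroup.inv_mk, FreeGroup.invRev]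
        rw [this]
        exact exists_mul_letter a (-1) (by simp) hL
  simpa only [FreeGroup.mk_toWord] using this g.toWord

lemma valid_join {L M} (hL : Valid L) (hM : Valid M)
    (h : ∀ p ∈ L.head?, ∀ q ∈ M.head?, p.1 ≠ q.1) : Valid (rv L ++ M) := by
  refine ⟨List.IsChain.append (valid_rv hL).1 hM.1 ?_, ?_⟩
  · intro x hx y hy
    rw [rv, List.getLast?_reverse, List.head?_map] at hx
    simp only [Option.mem_def, Option.map_eq_some_iff] at hx
    obtain ⟨p, hp, rfl⟩ := hx
    exact h p hp y hy
  · intro p hp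
    rcases List.mem_append.1 hp with hp | hp
    · exact (valid_rv hL).2 p hp
    · exact hM.2 p hp

lemma main_id (s : ℝ) (n : ℕ) {L M} (hL : Valid L) (hM : Valid M) (hn : L.length ≤ n) :
    s ^ l2sq ((ev L)⁻¹ * ev M) = rker s n L M + s ^ nn L * s ^ nn M := by
  have simple : ∀ {L M}, Valid L → Valid M → (∀ p ∈ L.head?, ∀ q ∈ M.head?, p.1 ≠ q.1) →
      s ^ l2sq ((ev L)⁻¹ * ev M) = s ^ nn L * s ^ nn M := by
    intro L M hL hM h
    rw [← ev_rv, ← ev_append, l2sq_ev (valid_join hL hM h), nn_append, nn_rv, pow_add]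
  induction n generalizing L M with
  | zero =>
    obtain rfl : L = [] := List.length_eq_zero_iff.1 (by omega)
    rw [rker_nil_left, zero_add, simple hL hM (by simp)]
  | succ n ih =>
    rcases L with _ | ⟨⟨a, k⟩, L⟩
    · rw [rker_nil_left, zero_add, simple hL hM (by simp)]
    rcases M with _ | ⟨⟨b, l⟩, M⟩
    · rw [rker_nil_right, zero_add, simple hL hM (by simp)]
    rw [rker_cons]
    by_cases hab : a = b
    · subst hab
      have e : (ev ((a, k) :: L))⁻¹ * ev ((a, l) :: M)
          = (ev L)⁻¹ * (FreeGroup.of a ^ (l - k) * ev M) := by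
        simp only [ev, List.map_cons, List.prod_cons, mul_inv_rev, mul_assoc, zpow_sub]
        rw [← mul_assoc ((FreeGroup.of a ^ k)⁻¹), ← mul_assoc (FreeGroup.of a ^ l),
          ← zpow_neg, ← zpow_add, ← zpow_add, add_comm]
      have n1 : nn ((a, k) :: L) = k.natAbs ^ 2 + nn L := by simp [nn]
      have n2 : nn ((a, l) :: M) = l.natAbs ^ 2 + nn M := by simp [nn]
      rw [e, if_pos rfl, n1, n2]
      by_cases hkl : k = l
      · subst hkl
        rw [if_pos rfl, sub_self, zpow_zero, one_mul,
          ih (valid_tail hL) (valid_tail hM) (by simpa using hn)]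
        simp [vker, pow_add]
        ring
      · have hlk : l - k ≠ 0 := by omega
        have e2 : FreeGroup.of a ^ (l - k) * ev M = ev ((a, l - k) :: M) := by simp [ev]
        rw [if_neg hkl, e2, simple (valid_tail hL)
          (valid_cons hlk (valid_tail hM) (valid_head hM))]
        · have n3 : nn ((a, l - k) :: M) = (l - k).natAbs ^ 2 + nn M := by simp [nn]
          rw [n3]
          simp [vker, pow_add]
          ring
        · intro p hp q hq
          simp at hq
          subst hq
          exact (valid_head hL p hp).symm
    · rw [if_neg hab, zero_add, simple hL hM (by simpa using hab)]

lemma psd_group (s : ℝ) (hs : |s| ≤ 1) :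
    (Matrix.of fun x y : FreeGroup ℕ => s ^ l2sq (x⁻¹ * y) : Matrix _ _ ℝ).PosSemidef := by
  choose B hB hev using exists_ev
  refine psd_limit (fun n => (rker s n).submatrix B B +
    Matrix.of fun x y => s ^ nn (B x) * s ^ nn (B y)) _ ?_ ?_
  · intro n
    exact ((psd_rker s hs n).submatrix B).add (psd_rank_one _)
  · intro x y
    refine tendsto_const_nhds.congr' ?_
    filter_upwards [Filter.eventually_ge_atTop (B x).length] with n hn
    have := main_id s n (hB x) (hB y) hn
    rw [hev, hev] at this
    simpa using this

lemma real_form (s : ℝ) (hs : |s| ≤ 1) (n : ℕ) (x : Fin n → FreeGroup ℕ) (a : Fin n → ℝ) :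
    0 ≤ ∑ j, ∑ k, a j * a k * s ^ l2sq ((x j)⁻¹ * x k) := by
  have h := ((psd_group s hs).submatrix x).dotProduct_mulVec_nonneg a
  simp only [dotProduct, Matrix.mulVec, Finset.mul_sum] at h
  refine h.trans_eq (Finset.sum_congr rfl fun j _ => Finset.sum_congr rfl fun k _ => ?_)
  simp
  ring

lemma l2sq_symm (s : ℝ) (hs : |s| ≤ 1) (x y : FreeGroup ℕ) :
    s ^ l2sq (x⁻¹ * y) = s ^ l2sq (y⁻¹ * x) := by
  have := (psd_group s hs).1.apply y x
  simpa using this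

end L2Moment

open L2Moment in
/-- For any Borel probability measure `μ` on `[-1,1]`, the function
`g ↦ ∫_{-1}^1 s^{‖g‖₂²} dμ(s)` is positive definite on the free group on countably
infinitely many generators. -/
theorem moment_l2sq_posDef
    (μ : Measure (Set.Icc (-1 : ℝ) 1)) [IsProbabilityMeasure μ] :
    IsPositiveDefinite
      (fun g : FreeGroup ℕ => ∫ s : Set.Icc (-1 : ℝ) 1, (s : ℝ) ^ l2sq g ∂μ) := by
  intro n x c
  have hs : ∀ s : Set.Icc (-1 : ℝ) 1, |(s : ℝ)| ≤ 1 := fun s => abs_le.2 s.2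
  have hint : ∀ m : ℕ, Integrable (fun s : Set.Icc (-1 : ℝ) 1 => (s : ℝ) ^ m) μ := fun m =>
    Continuous.integrable_of_hasCompactSupport (by fun_prop) (HasCompactSupport.of_compactSpace _)
  set K : Fin n → Fin n → ℝ := fun j k =>
    ∫ s : Set.Icc (-1 : ℝ) 1, (s : ℝ) ^ l2sq ((x j)⁻¹ * x k) ∂μ with hK
  have hsymm : ∀ j k, K j k = K k j := fun j k =>
    integral_congr_ae (Filter.Eventually.of_forall fun s => l2sq_symm s (hs s) _ _)
  have hpos : ∀ a : Fin n → ℝ, 0 ≤ ∑ j, ∑ k, a j * a k * K j k := by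
    intro a
    have : ∑ j, ∑ k, a j * a k * K j k =
        ∫ s : Set.Icc (-1 : ℝ) 1, ∑ j, ∑ k, a j * a k * (s : ℝ) ^ l2sq ((x j)⁻¹ * x k) ∂μ := by
      rw [integral_finsetSum _ fun j _ => integrable_finsetSum _ fun k _ => (hint _).const_mul _]
      refine Finset.sum_congr rfl fun j _ => ?_
      rw [integral_finsetSum _ fun k _ => (hint _).const_mul _]
      refine Finset.sum_congr rfl fun k _ => ?_
      rw [integral_const_mul]
    rw [this]
    exact integral_nonneg fun s => real_form s (hs s) n x a
  change 0 ≤ ∑ j, ∑ k, c j * (starRingEnd ℂ) (c k) * (K j k : ℂ)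
  rw [Complex.nonneg_iff]
  constructor
  · have h1 := hpos fun j => (c j).re
    have h2 := hpos fun j => (c j).im
    refine (add_nonneg h1 h2).trans_eq ?_
    simp only [Complex.re_sum, ← Finset.sum_add_distrib]
    refine Finset.sum_congr rfl fun j _ => Finset.sum_congr rfl fun k _ => ?_
    simp
    ring
  · have h : (∑ j, ∑ k, c j * (starRingEnd ℂ) (c k) * (K j k : ℂ)).im
        = ∑ j, ∑ k, (c j).im * (c k).re * K j k - ∑ j, ∑ k, (c j).re * (c k).im * K j k := by
      simp only [Complex.im_sum, ← Finset.sum_sub_distrib]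
      refine Finset.sum_congr rfl fun j _ => Finset.sum_congr rfl fun k _ => ?_
      simp
      ring
    rw [h, Finset.sum_comm, eq_comm, sub_eq_zero]
    refine Finset.sum_congr rfl fun j _ => Finset.sum_congr rfl fun k _ => ?_
    rw [hsymm k j]
    ring
end
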